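/- For any $\sigma \in [1/2, 1]$, $U \geq 1$, and $\varepsilon > 0$, one has $\int_U^{2U} |L(\sigma + it, \chi)|^4 \, dt \ll_\varepsilon U^{1+\varepsilon}$, where $\chi$ is the non-principal Dirichlet character modulo 4. -/

import Mathlib

/-- The Dirichlet L-function of the non-principal character modulo 4. -/
noncomputable def Lchi4 (s : ℂ) : ℂ :=
  DirichletCharacter.LFunction (ZMod.χ₄.ringHomComp (Int.castRingHom ℂ)) s


theorem aux_divisor_bound (η : ℝ) (hη : 0 < η) :
    ∃ C : ℝ, 0 < C ∧ ∀ n : ℕ, n ≠ 0 → ((n.divisors.card : ℕ) : ℝ) ≤ C * (n : ℝ) ^ η := by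
  have hl2 : 0 < Real.log 2 := Real.log_pos (by norm_num)
  set A : ℝ := 1 + 1 / (η * Real.log 2) with hA
  have hA1 : 1 ≤ A := by rw [hA]; have : 0 < 1 / (η * Real.log 2) := by positivity
                         linarith
  obtain ⟨P, hP⟩ := exists_nat_gt ((2:ℝ) ^ (1/η))
  refine ⟨A ^ P, by positivity, fun n hn => ?_⟩
  rw [Nat.card_divisors hn]
  have key : ∀ p ∈ n.primeFactors, ((n.factorization p + 1 : ℕ) : ℝ) ≤
      (if p < P then A else 1) * ((p ^ n.factorization p : ℕ) : ℝ) ^ η := by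
    intro p hp
    have hp2 : 2 ≤ p := (Nat.prime_of_mem_primeFactors hp).two_le
    have hp2' : (2:ℝ) ≤ p := by exact_mod_cast hp2
    set v := n.factorization p
    have e : ((p ^ v : ℕ) : ℝ) ^ η = ((p:ℝ) ^ η) ^ v := by
      push_cast
      rw [← Real.rpow_natCast, ← Real.rpow_mul (by positivity), mul_comm,
        Real.rpow_mul (by positivity), Real.rpow_natCast]
    rw [e]
    split_ifs with h
    · have h1 : (2:ℝ) ^ η ≤ (p:ℝ) ^ η := Real.rpow_le_rpow (by norm_num) hp2' hη.le
      have h2 : ((2:ℝ) ^ η) ^ v ≤ ((p:ℝ) ^ η) ^ v := pow_le_pow_left₀ (by positivity) h1 v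
      have h3 : 1 + η * Real.log 2 * v ≤ ((2:ℝ) ^ η) ^ v := by
        rw [Real.rpow_def_of_pos (by norm_num), ← Real.exp_nat_mul]
        have := Real.add_one_le_exp ((v:ℝ) * (Real.log 2 * η))
        linarith
      have h4 : ((v + 1 : ℕ):ℝ) ≤ A * (1 + η * Real.log 2 * v) := by
        rw [hA]; push_cast
        have : (1 + 1 / (η * Real.log 2)) * (1 + η * Real.log 2 * v) =
          1 + η * Real.log 2 * v + 1 / (η * Real.log 2) + v := by
          field_simp
          ring
        rw [this]
        have : 0 ≤ η * Real.log 2 * v := by positivity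
        have : 0 ≤ 1 / (η * Real.log 2) := by positivity
        linarith
      calc _ ≤ _ := h4
        _ ≤ A * ((p:ℝ)^η)^v := by gcongr; linarith
    · have h1 : (2:ℝ) ≤ (p:ℝ) ^ η := by
        have : (2:ℝ) ^ (1/η) ≤ p := by
          have : (P:ℝ) ≤ p := by exact_mod_cast (not_lt.mp h)
          linarith
        calc (2:ℝ) = ((2:ℝ) ^ (1/η)) ^ η := by
              rw [← Real.rpow_mul (by norm_num)]; field_simp; simp
          _ ≤ _ := Real.rpow_le_rpow (by positivity) this hη.le
      have h2 : (2:ℝ) ^ v ≤ ((p:ℝ) ^ η) ^ v := pow_le_pow_left₀ (by positivity) h1 v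
      have h3 : ((v + 1 : ℕ) : ℝ) ≤ 2 ^ v := by exact_mod_cast Nat.lt_two_pow_self
      linarith
  push_cast at key ⊢
  calc _ ≤ ∏ p ∈ n.primeFactors, (if p < P then A else 1) * (((p:ℝ) ^ n.factorization p)) ^ η :=
        Finset.prod_le_prod (fun _ _ => by positivity) key
    _ = (∏ p ∈ n.primeFactors, (if p < P then A else 1)) * (n:ℝ) ^ η := by
        rw [Finset.prod_mul_distrib]
        congr 1
        rw [Real.finsetProd_rpow _ _ (fun _ _ => by positivity)]
        congr 1
        conv_rhs => rw [← Nat.prod_factorization_pow_eq_self hn]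
        rw [Finsupp.prod]
        push_cast
        rfl
    _ ≤ A ^ P * (n:ℝ) ^ η := by
        gcongr
        rw [← Finset.prod_filter, Finset.prod_const]
        apply pow_le_pow_right₀ hA1
        calc _ ≤ (Finset.range P).card := Finset.card_le_card (by intro p; simp)
          _ = P := Finset.card_range P

open Real in
theorem aux_gamma_cvx {T x a : ℝ} (hT : 0 ≤ T) (hx : 0 < x) (ha0 : 0 ≤ a) (ha1 : a ≤ 1) :
    1 + T / (x + a) ^ 2 ≤ (1 + T / x ^ 2) ^ (1 - a) * (1 + T / (x + 1) ^ 2) ^ a := by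
  set X := T / x ^ 2
  set Y := T / (x + 1) ^ 2
  have hX : 0 ≤ X := by positivity
  have hY : 0 ≤ Y := by positivity
  have h1 : T / (x+a)^2 ≤ X ^ (1-a) * Y ^ a := by
    have g : x ^ (1-a) * (x+1) ^ a ≤ x + a := by
      have := Real.geom_mean_le_arith_mean2_weighted (w₁ := 1-a) (w₂ := a) (by linarith) ha0 hx.le
        (by linarith : 0 ≤ x+1) (by ring)
      linarith
    have e : X ^ (1-a) * Y ^ a = T / (x ^ (1-a) * (x+1) ^ a)^2 := by
      have l1 : (x ^ (1-a)) ^ 2 = (x^2) ^ (1-a) := by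
        rw [← Real.rpow_natCast, ← Real.rpow_natCast, ← Real.rpow_mul hx.le, ← Real.rpow_mul hx.le, mul_comm]
      have l2 : ((x+1) ^ a) ^ 2 = ((x+1)^2) ^ a := by
        rw [← Real.rpow_natCast, ← Real.rpow_natCast, ← Real.rpow_mul (by positivity), ← Real.rpow_mul (by positivity), mul_comm]
      rw [Real.div_rpow hT (by positivity), Real.div_rpow hT (by positivity), mul_pow, l1, l2, div_mul_div_comm]
      congr 1
      rw [← Real.rpow_add_of_nonneg hT (by linarith) ha0]; simp
    rw [e]
    gcongr
  clear_value X Y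
  have s1 := Real.geom_mean_le_arith_mean2_weighted (w₁ := 1-a) (w₂ := a) (p₁ := 1/(1+X)) (p₂ := 1/(1+Y)) (by linarith) ha0
    (by positivity) (by positivity) (by ring)
  have s2 := Real.geom_mean_le_arith_mean2_weighted (w₁ := 1-a) (w₂ := a) (p₁ := X/(1+X)) (p₂ := Y/(1+Y)) (by linarith) ha0
    (by positivity) (by positivity) (by ring)
  rw [Real.div_rpow (by positivity) (by positivity), Real.div_rpow (by positivity) (by positivity), div_mul_div_comm] at s1 s2
  have s3 : (1 - a) * (1 / (1 + X)) + a * (1 / (1 + Y)) + ((1 - a) * (X / (1 + X)) + a * (Y / (1 + Y))) = 1 := by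
    field_simp; ring
  have s4 : (1 + X ^ (1-a) * Y ^ a) / ((1+X)^(1-a) * (1+Y)^a) ≤ 1 := by
    rw [add_div]
    simp only [Real.one_rpow, mul_one] at s1
    linarith
  rw [div_le_one (by positivity)] at s4
  linarith

theorem aux_gamma_prod {T a : ℝ} (hT : 0 ≤ T) (ha0 : 3/4 ≤ a) (ha1 : a ≤ 1) (n : ℕ) :
    (∏ j ∈ Finset.range (n+1), (1 + T / (a + j) ^ 2)) * (1 + T / (n+1:ℝ) ^ 2) ^ (1 - a) ≤
    2 * (1 + T) ^ (1 - a) * ∏ j ∈ Finset.range (n+1), (1 + T / (1 + j:ℝ) ^ 2) := by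
  induction n with
  | zero =>
    simp only [zero_add, Finset.range_one, Finset.prod_singleton, Nat.cast_zero, add_zero, one_pow, div_one]
    have : 1 + T / a^2 ≤ 2 * (1 + T) := by
      have : T / a ^ 2 ≤ 2 * T := by
        rw [div_le_iff₀ (by positivity)]
        have h2 : 1/2 ≤ a^2 := by nlinarith
        nlinarith
      linarith
    calc _ ≤ (2 * (1+T)) * (1+T)^(1-a) := by gcongr
      _ = _ := by ring
  | succ n ih =>
    rw [Finset.prod_range_succ, Finset.prod_range_succ (n := n+1)]
    have := aux_gamma_cvx (T := T) (x := (n:ℝ)+1) (a := a) hT (by positivity) (by linarith) ha1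
    push_cast
    set A := ∏ j ∈ Finset.range (n+1), (1 + T / (a + j) ^ 2)
    set B := ∏ j ∈ Finset.range (n+1), (1 + T / (1 + j:ℝ) ^ 2)
    have hA : 0 ≤ A := Finset.prod_nonneg fun _ _ => by positivity
    set q1 := 1 + T / ((n:ℝ)+1)^2
    rw [show a + ((n:ℝ)+1) = n + 1 + a by ring, show 1 + ((n:ℝ)+1) = n + 1 + 1 by ring]
    set q2 := 1 + T / ((n:ℝ)+1+1)^2
    have hq1 : 0 < q1 := by positivity
    have hq2 : 0 < q2 := by positivity
    calc _ ≤ A * (q1 ^ (1-a) * q2 ^ a) * q2 ^ (1-a) := by gcongr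
      _ = A * q1 ^ (1-a) * q2 := by
        rw [mul_assoc, mul_assoc (q1 ^ _), ← Real.rpow_add hq2]
        simp [mul_assoc]
      _ ≤ (2 * (1+T)^(1-a) * B) * q2 := by gcongr
      _ = _ := by ring

theorem aux_gammaSeq_norm {a τ : ℝ} (ha : 0 < a) (n : ℕ) (hn : n ≠ 0) :
    ‖Complex.GammaSeq (a + τ * Complex.I) n‖ ^ 2 * (∏ j ∈ Finset.range (n+1), (1 + τ^2 / (a + j) ^ 2))
      = (Real.GammaSeq a n) ^ 2 := by
  unfold Complex.GammaSeq Real.GammaSeq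
  rw [norm_div, norm_mul, norm_prod]
  have h1 : ‖(n:ℂ) ^ ((a:ℂ) + τ * Complex.I)‖ = (n:ℝ) ^ a := by
    have : (n:ℂ) = ((n:ℝ):ℂ) := by simp
    rw [this, Complex.norm_cpow_eq_rpow_re_of_pos (by positivity)]
    simp
  rw [h1]
  have h2 : ∀ j ∈ Finset.range (n+1), (1 + τ^2 / (a + j) ^ 2) = ‖(a:ℂ) + τ * Complex.I + j‖^2 / (a+j)^2 := by
    intro j _
    rw [← Complex.normSq_eq_norm_sq, Complex.normSq_apply]
    simp
    field_simp
  rw [Finset.prod_congr rfl h2, Finset.prod_div_distrib, Finset.prod_pow, Finset.prod_pow]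
  have h3 : 0 < ∏ j ∈ Finset.range (n+1), ‖(a:ℂ) + τ * Complex.I + j‖ := by
    apply Finset.prod_pos
    intro j _
    rw [norm_pos_iff]
    intro h
    have := congrArg Complex.re h
    simp at this
    have : 0 ≤ (j:ℝ) := by positivity
    linarith
  have h4 : 0 < ∏ j ∈ Finset.range (n+1), (a + (j:ℝ)) := Finset.prod_pos fun _ _ => by positivity
  simp only [Complex.norm_natCast]
  field_simp

theorem aux_gamma_one {τ : ℝ} (hτ : 1/2 ≤ τ) :
    τ * Real.exp (-Real.pi * τ) ≤ ‖Complex.Gamma (1 + τ * Complex.I)‖ ^ 2 := by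
  have h0 : (τ:ℂ) * Complex.I ≠ 0 := by
    simp; linarith
  have h1 : Complex.Gamma (1 + τ * Complex.I) * Complex.Gamma (1 - τ * Complex.I) =
     Real.pi * τ / Real.sinh (Real.pi * τ) := by
    rw [add_comm, Complex.Gamma_add_one _ h0, mul_assoc, Complex.Gamma_mul_Gamma_one_sub,
      ← mul_assoc, Complex.sin_mul_I]
    push_cast
    have : Complex.sinh (Real.pi * τ) ≠ 0 := by
      rw [← Complex.ofReal_mul, ← Complex.ofReal_sinh]
      norm_cast
      exact (Real.sinh_pos_iff.mpr (by positivity)).ne'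
    field_simp
  have h2 : Complex.Gamma (1 - τ * Complex.I) = (starRingEnd ℂ) (Complex.Gamma (1 + τ * Complex.I)) := by
    rw [← Complex.Gamma_conj]; simp [sub_eq_add_neg]
  rw [h2, Complex.mul_conj, Complex.normSq_eq_norm_sq] at h1
  have h3 : ‖Complex.Gamma (1 + τ * Complex.I)‖ ^ 2 = Real.pi * τ / Real.sinh (Real.pi * τ) := by
    exact_mod_cast h1
  rw [h3, le_div_iff₀ (Real.sinh_pos_iff.mpr (by positivity))]
  have h4 : Real.sinh (Real.pi * τ) ≤ Real.exp (Real.pi * τ) := by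
    rw [Real.sinh_eq]
    have := Real.exp_pos (Real.pi * τ)
    have := Real.exp_pos (-(Real.pi * τ))
    linarith
  calc _ ≤ τ * Real.exp (-Real.pi * τ) * Real.exp (Real.pi * τ) := by gcongr
    _ = τ := by rw [mul_assoc, ← Real.exp_add]; simp
    _ ≤ _ := by nlinarith [Real.pi_gt_three]

theorem aux_gamma_lower : ∃ c : ℝ, 0 < c ∧ ∀ κ : ℝ, 3/4 ≤ κ → κ ≤ 1 → ∀ τ : ℝ, 1/2 ≤ τ →
    c * τ ^ (2*κ-1) * Real.exp (-Real.pi * τ) ≤ ‖Complex.Gamma (κ + τ * Complex.I)‖ ^ 2 := by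
  obtain ⟨κ₀, hκ₀, hmin⟩ := (isCompact_Icc (a := (3/4:ℝ)) (b := 1)).exists_isMinOn
    ⟨3/4, by norm_num⟩ (f := Real.Gamma) (by
      intro x hx
      exact (Real.differentiableAt_Gamma (fun m => by
        have := hx.1
        have : (0:ℝ) ≤ m := by positivity
        linarith)).continuousAt.continuousWithinAt)
  have hg0 : 0 < Real.Gamma κ₀ := Real.Gamma_pos_of_pos (by linarith [hκ₀.1])
  refine ⟨Real.Gamma κ₀ ^ 2 / 10, by positivity, fun κ h1 h2 τ hτ => ?_⟩
  have hg : Real.Gamma κ₀ ≤ Real.Gamma κ := hmin ⟨h1, h2⟩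
  -- main inequality in the limit
  have hlim : Real.Gamma κ ^ 2 * ‖Complex.Gamma (1 + τ * Complex.I)‖ ^ 2 ≤
      ‖Complex.Gamma (κ + τ * Complex.I)‖ ^ 2 * (2 * (1 + τ^2) ^ (1 - κ)) * Real.Gamma 1 ^ 2 := by
    have t1 := (Real.GammaSeq_tendsto_Gamma κ).pow 2
    have t2 := (Real.GammaSeq_tendsto_Gamma 1).pow 2
    have t3 := ((Complex.GammaSeq_tendsto_Gamma (κ + τ * Complex.I)).norm).pow 2
    have t4 := ((Complex.GammaSeq_tendsto_Gamma (1 + τ * Complex.I)).norm).pow 2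
    refine le_of_tendsto_of_tendsto (t1.mul t4) ((t3.mul_const _).mul t2) ?_
    filter_upwards [Filter.eventually_ne_atTop 0] with n hn
    have e1 := aux_gammaSeq_norm (a := κ) (τ := τ) (by linarith) n hn
    have e2 := aux_gammaSeq_norm (a := 1) (τ := τ) (by norm_num) n hn
    have e3 := aux_gamma_prod (T := τ^2) (sq_nonneg τ) h1 h2 n
    have e4 : 1 ≤ (1 + τ^2 / (n+1:ℝ) ^ 2) ^ (1 - κ) :=
      Real.one_le_rpow (by have : 0 ≤ τ^2 / (n+1:ℝ)^2 := by positivity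
                           linarith) (by linarith)
    rw [← e1, ← e2]
    push_cast
    set A := ∏ j ∈ Finset.range (n+1), (1 + τ^2 / (κ + j) ^ 2)
    have hA : 0 ≤ A := Finset.prod_nonneg fun _ _ => by positivity
    have e5 : A ≤ _ := (le_mul_of_one_le_right hA e4).trans e3
    calc _ = ‖Complex.GammaSeq (κ + τ * Complex.I) n‖ ^ 2 * ‖Complex.GammaSeq (1 + τ * Complex.I) n‖ ^ 2 * A := by ring
      _ ≤ ‖Complex.GammaSeq (κ + τ * Complex.I) n‖ ^ 2 * ‖Complex.GammaSeq (1 + τ * Complex.I) n‖ ^ 2 *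
          (2 * (1 + τ ^ 2) ^ (1 - κ) * ∏ j ∈ Finset.range (n + 1), (1 + τ ^ 2 / (1 + (j:ℝ)) ^ 2)) := by
          gcongr
      _ = _ := by ring
  have h3 := aux_gamma_one hτ
  have hτ0 : 0 < τ := by linarith
  have h4 : (1 + τ^2) ^ (1 - κ) ≤ 5 * τ ^ (2 - 2 * κ) := by
    calc (1 + τ^2) ^ (1 - κ) ≤ (5 * τ^2) ^ (1-κ) := by
          apply Real.rpow_le_rpow (by positivity) (by nlinarith) (by linarith)
      _ = 5 ^ (1-κ) * τ ^ (2 - 2*κ) := by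
          rw [Real.mul_rpow (by norm_num) (by positivity), ← Real.rpow_natCast τ 2, ← Real.rpow_mul hτ0.le]
          congr 2; push_cast; ring
      _ ≤ 5 ^ (1:ℝ) * τ ^ (2 - 2*κ) := by
          gcongr
          · norm_num
          · linarith
      _ = _ := by simp
  rw [Real.Gamma_one] at hlim
  have h5 : Real.Gamma κ₀ ^ 2 * (τ * Real.exp (-Real.pi * τ)) ≤ 
     ‖Complex.Gamma (κ + τ * Complex.I)‖ ^ 2 * (10 * τ ^ (2 - 2 * κ)) := by
    calc _ ≤ Real.Gamma κ ^ 2 * ‖Complex.Gamma (1 + τ * Complex.I)‖ ^ 2 := by gcongr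
      _ ≤ _ := hlim
      _ ≤ ‖Complex.Gamma (κ + τ * Complex.I)‖ ^ 2 * (2 * (5 * τ ^ (2 - 2 * κ))) * 1 ^ 2 := by gcongr
      _ = _ := by ring
  have h6 : τ ^ (2*κ-1) * τ ^ (2 - 2*κ) = τ := by
    rw [← Real.rpow_add hτ0]; ring_nf; simp
  have h7 : 0 < τ ^ (2 - 2*κ) := by positivity
  have : Real.Gamma κ₀ ^ 2 / 10 * τ ^ (2*κ-1) * Real.exp (-Real.pi * τ) * (10 * τ ^ (2 - 2*κ)) ≤
      ‖Complex.Gamma (κ + τ * Complex.I)‖ ^ 2 * (10 * τ ^ (2 - 2 * κ)) := by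
    calc _ = Real.Gamma κ₀ ^ 2 * ((τ ^ (2*κ-1) * τ ^ (2 - 2*κ)) * Real.exp (-Real.pi * τ)) := by ring
      _ ≤ _ := by rw [h6]; exact h5
  exact le_of_mul_le_mul_right this (by positivity)

open MeasureTheory Complex in
theorem aux_plancherel (h : ℝ → ℂ) (h1 : Integrable h) (h2 : Integrable (fun v => ‖h v‖ ^ 2))
    (a B : ℝ) (ha : 0 ≤ a) (haB : a ≤ B) (hB : 0 < B) :
    ∫ t in a..B, ‖∫ v, h v * cexp (I * t * v)‖ ^ 2 ≤ 2 * Real.pi * Real.exp 1 * ∫ v, ‖h v‖ ^ 2 := by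
  set H : ℝ → ℂ := fun t => ∫ v, h v * cexp (I * t * v) with hH
  have nexp : ∀ t v : ℝ, ‖cexp (I * t * v)‖ = 1 := by
    intro t v
    rw [show I * (t:ℂ) * v = ((t * v : ℝ) : ℂ) * I by push_cast; ring]
    exact norm_exp_ofReal_mul_I _
  set b : ℝ := 1 / B ^ 2 with hb
  have hb0 : 0 < b := by positivity
  have Hint : ∀ t : ℝ, Integrable (fun v => h v * cexp (I * t * v)) := by
    intro t
    refine h1.mul_bdd (c := 1) (by fun_prop) (Filter.Eventually.of_forall fun v => (nexp t v).le)
  have Hbd : ∀ t, ‖H t‖ ≤ ∫ v, ‖h v‖ := by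
    intro t
    refine (norm_integral_le_integral_norm _).trans (le_of_eq ?_)
    congr 1; ext v; rw [norm_mul, nexp, mul_one]
  have Hcont : Continuous H := by
    apply continuous_of_dominated (bound := fun v => ‖h v‖)
    · intro t; exact (Hint t).aestronglyMeasurable
    · intro t; exact Filter.Eventually.of_forall fun v => by rw [norm_mul, nexp, mul_one]
    · exact h1.norm
    · exact Filter.Eventually.of_forall fun v => by fun_prop
  have gint : Integrable (fun t : ℝ => Real.exp (-b * t^2)) := integrable_exp_neg_mul_sq hb0
  have wint : Integrable (fun t : ℝ => Real.exp (-b * t^2) * ‖H t‖^2) := by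
    refine gint.mul_bdd (c := (∫ v, ‖h v‖)^2) (by fun_prop) (Filter.Eventually.of_forall fun v => ?_)
    rw [norm_pow, norm_norm]
    gcongr; exact Hbd v
  -- step 1
  have s1 : ∫ t in a..B, ‖H t‖ ^ 2 ≤ Real.exp 1 * ∫ t, Real.exp (-b * t^2) * ‖H t‖^2 := by
    rw [intervalIntegral.integral_of_le haB, ← integral_const_mul]
    calc ∫ t in Set.Ioc a B, ‖H t‖ ^ 2 ≤ ∫ t in Set.Ioc a B, Real.exp 1 * (Real.exp (-b * t^2) * ‖H t‖^2) := by
          apply setIntegral_mono_on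
          · exact (Hcont.norm.pow 2).integrableOn_Ioc
          · exact (wint.const_mul _).integrableOn
          · exact measurableSet_Ioc
          · intro t ht
            rw [← mul_assoc, ← Real.exp_add]
            have : t ^ 2 ≤ B^2 := by
              have := ht.1; have := ht.2
              gcongr; linarith
            have : b * t^2 ≤ 1 := by
              rw [hb, div_mul_eq_mul_div, one_mul, div_le_one (by positivity)]; exact this
            have : 1 ≤ Real.exp (1 + -b * t^2) := Real.one_le_exp (by linarith)
            nlinarith [sq_nonneg ‖H t‖]
      _ ≤ _ := by
          apply setIntegral_le_integral (wint.const_mul _)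
          exact Filter.Eventually.of_forall fun t => by positivity
  -- step 2
  set K : ℝ × (ℝ × ℝ) → ℂ := fun p => ((Real.exp (-b * p.1^2) : ℝ) : ℂ) * (h p.2.1 * (starRingEnd ℂ) (h p.2.2)) * 
     cexp (I * p.1 * (p.2.1 - p.2.2)) with hK
  have hconj : Integrable (fun w => (starRingEnd ℂ) (h w)) := 
    (Complex.conjCLE.toContinuousLinearMap.integrable_comp h1)
  have hhint : Integrable (fun q : ℝ × ℝ => h q.1 * (starRingEnd ℂ) (h q.2)) := h1.mul_prod hconj
  have Kint : Integrable K := by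
    have : Integrable (fun p : ℝ × (ℝ × ℝ) => ((Real.exp (-b * p.1^2) : ℝ) : ℂ) * (h p.2.1 * (starRingEnd ℂ) (h p.2.2))) :=
      (gint.ofReal (𝕜 := ℂ)).mul_prod hhint
    refine this.mul_bdd (c := 1) (by fun_prop) (Filter.Eventually.of_forall fun p => le_of_eq ?_)
    have := nexp p.1 (p.2.1 - p.2.2)
    push_cast at this
    exact this
  have s2 : ∀ t : ℝ, ∫ q : ℝ × ℝ, K (t, q) = ((Real.exp (-b * t^2) * ‖H t‖^2 : ℝ) : ℂ) := by
    intro t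
    have e : ∀ q : ℝ × ℝ, K (t, q) = ((Real.exp (-b * t^2) : ℝ) : ℂ) * 
       ((h q.1 * cexp (I * t * q.1)) * (starRingEnd ℂ) (h q.2 * cexp (I * t * q.2))) := by
      intro q
      simp only [hK, map_mul, ← Complex.exp_conj, Complex.conj_I, Complex.conj_ofReal]
      rw [show I * (t:ℂ) * (q.1 - q.2) = I * t * q.1 + -I * t * q.2 by ring, Complex.exp_add]
      ring
    simp_rw [e]
    rw [integral_const_mul, Measure.volume_eq_prod, integral_prod_mul (fun v => h v * cexp (I * t * v)) (fun v => (starRingEnd ℂ) (h v * cexp (I * t * v))),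
      integral_conj, Complex.mul_conj, Complex.normSq_eq_norm_sq]
    push_cast
    rfl
  set g : ℝ → ℝ := fun x => √(Real.pi / b) * Real.exp (-(1/(4*b)) * x^2) with hg
  have gint' : Integrable g := (integrable_exp_neg_mul_sq (by positivity)).const_mul _
  have gtot : ∫ x, g x = 2 * Real.pi := by
    simp only [hg]
    rw [integral_const_mul, integral_gaussian, ← Real.sqrt_mul (by positivity)]
    rw [show Real.pi / b * (Real.pi / (1 / (4 * b))) = (2 * Real.pi)^2 by field_simp; ring]
    exact Real.sqrt_sq (by positivity)
  have s3 : ∀ q : ℝ × ℝ, ∫ t : ℝ, K (t, q) = h q.1 * (starRingEnd ℂ) (h q.2) * (g (q.1 - q.2) : ℝ) := by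
    intro q
    have e : ∀ t : ℝ, K (t, q) = (h q.1 * (starRingEnd ℂ) (h q.2)) * (cexp (I * ((q.1 - q.2 : ℝ) : ℂ) * t) * cexp (-(b:ℂ) * t^2)) := by
      intro t
      simp only [hK]
      push_cast
      rw [show I * (t:ℂ) * (q.1 - q.2) = I * (q.1 - q.2) * t by ring]
      ring
    simp_rw [e]
    rw [integral_const_mul]
    congr 1
    have := fourierIntegral_gaussian (b := (b:ℂ)) (by simpa using hb0) (((q.1 - q.2 : ℝ) : ℂ))
    rw [this]
    simp only [hg]
    rw [Real.sqrt_eq_rpow]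
    push_cast
    rw [Complex.ofReal_cpow (by positivity)]
    push_cast
    congr 2
    field_simp
  have s4 : (∫ t, ((Real.exp (-b * t^2) * ‖H t‖^2 : ℝ) : ℂ)) = ∫ q : ℝ × ℝ, h q.1 * (starRingEnd ℂ) (h q.2) * (g (q.1 - q.2) : ℝ) := by
    simp_rw [← s2, ← s3]
    exact integral_integral_swap Kint
  have c1 : Integrable (fun p : ℝ × ℝ => ‖h p.2‖^2 * g (p.1 - p.2)) :=
    h2.convolution_integrand (ContinuousLinearMap.mul ℝ ℝ) gint'
  have c1v : ∫ p : ℝ × ℝ, ‖h p.2‖^2 * g (p.1 - p.2) = (∫ v, ‖h v‖^2) * (2 * Real.pi) := by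
    rw [← gtot, Measure.volume_eq_prod, integral_prod _ c1]
    exact integral_convolution (ContinuousLinearMap.mul ℝ ℝ) h2 gint'
  have gsymm : ∀ x y, g (x - y) = g (y - x) := by
    intro x y; simp only [hg]; congr 3; ring
  have c2 : Integrable (fun p : ℝ × ℝ => ‖h p.1‖^2 * g (p.1 - p.2)) := by
    have := c1.swap
    refine this.congr (Filter.Eventually.of_forall fun p => ?_)
    simp only [Function.comp, Prod.swap]
    rw [gsymm]
  have c2v : ∫ p : ℝ × ℝ, ‖h p.1‖^2 * g (p.1 - p.2) = (∫ v, ‖h v‖^2) * (2 * Real.pi) := by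
    rw [← c1v, Measure.volume_eq_prod, ← integral_prod_swap]
    congr 1; ext p
    simp only [Prod.swap]
    rw [gsymm]
  have s5 : ∫ t, Real.exp (-b * t^2) * ‖H t‖^2 ≤ (∫ v, ‖h v‖^2) * (2 * Real.pi) := by
    have e1 : ∫ t, Real.exp (-b * t^2) * ‖H t‖^2 = ‖∫ q : ℝ × ℝ, h q.1 * (starRingEnd ℂ) (h q.2) * (g (q.1 - q.2) : ℝ)‖ := by
      rw [← s4, integral_complex_ofReal, Complex.norm_real, Real.norm_of_nonneg]
      exact integral_nonneg fun t => by positivity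
    rw [e1]
    calc _ ≤ ∫ q : ℝ × ℝ, ((1/2) * (‖h q.2‖^2 * g (q.1 - q.2)) + (1/2) * (‖h q.1‖^2 * g (q.1 - q.2))) := by
          apply norm_integral_le_of_norm_le ((c1.const_mul _).add (c2.const_mul _))
          refine Filter.Eventually.of_forall fun q => ?_
          have g0 : 0 ≤ g (q.1 - q.2) := by simp only [hg]; positivity
          rw [norm_mul, norm_mul, RCLike.norm_conj, Complex.norm_real, Real.norm_of_nonneg g0]
          simp only [Pi.add_apply]
          nlinarith [mul_nonneg g0 (sq_nonneg (‖h q.1‖ - ‖h q.2‖))]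
      _ = _ := by
          rw [integral_add (c1.const_mul _) (c2.const_mul _), integral_const_mul, integral_const_mul, c1v, c2v]
          ring
  calc _ ≤ _ := s1
    _ ≤ Real.exp 1 * ((∫ v, ‖h v‖^2) * (2 * Real.pi)) := by gcongr
    _ = _ := by ring


open MeasureTheory Complex in
lemma aux_gauss_scale (ρ : ℝ) (hρ : 0 < ρ) (b : ℂ) (hb : 0 < b.re) :
    ∫ v : ℝ, cexp (-(ρ * b) * (v:ℂ)^2) = ((√ρ)⁻¹ : ℝ) * (Real.pi / b) ^ (1/2 : ℂ) := by
  rw [← integral_gaussian_complex hb]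
  have h := Measure.integral_comp_mul_left (fun v : ℝ => cexp (-b * (v:ℂ)^2)) (√ρ)
  rw [abs_of_nonneg (by positivity), Complex.real_smul] at h
  rw [← h]
  congr 1; ext v
  congr 1
  have : ((√ρ : ℝ) : ℂ)^2 = ρ := by
    rw [← Complex.ofReal_pow, Real.sq_sqrt hρ.le]
  push_cast
  rw [mul_pow, this]; ring

/-- auxiliary kernel -/
noncomputable def auxG (ω : ℂ) (y : ℝ) : ℂ :=
  ((√Real.pi)⁻¹ : ℝ) * (Real.pi / (ω + (y:ℂ)^2)) ^ (1/2 : ℂ)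

lemma auxG_norm (ω : ℂ) (hω : ‖ω‖ = 1) (hr : 0 < ω.re) (y : ℝ) : ‖auxG ω y‖ ≤ 1 := by
  have h0 : 1 ≤ ‖ω + (y:ℂ)^2‖ := by
    rw [Complex.norm_eq_sqrt_sq_add_sq] at hω ⊢
    rw [Real.sqrt_eq_one] at hω
    rw [Real.one_le_sqrt]
    have : ((y:ℂ)^2) = ((y^2 : ℝ) : ℂ) := by push_cast; rfl
    rw [this]
    simp only [Complex.add_re, Complex.ofReal_re, Complex.add_im, Complex.ofReal_im]
    nlinarith [sq_nonneg y, mul_nonneg hr.le (sq_nonneg y), sq_nonneg (y^2)]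
  have h1 : (Real.pi / (ω + (y:ℂ)^2)) ≠ 0 := by
    have : ω + (y:ℂ)^2 ≠ 0 := by
      intro h; rw [h] at h0; simp at h0; linarith
    have hp := Real.pi_ne_zero
    exact div_ne_zero (by exact_mod_cast hp) this
  unfold auxG
  rw [norm_mul, show (1/2 : ℂ) = ((1/2 : ℝ) : ℂ) by push_cast; rfl,
    Complex.norm_cpow_real, norm_div, Complex.norm_real, Complex.norm_real,
    ← Real.sqrt_eq_rpow, Real.norm_of_nonneg (by positivity), Real.norm_of_nonneg Real.pi_pos.le]
  rw [inv_mul_le_iff₀ (by positivity), mul_one]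
  apply Real.sqrt_le_sqrt
  exact div_le_self Real.pi_pos.le h0

lemma auxG_meas (ω : ℂ) : Measurable (auxG ω) := by
  unfold auxG
  fun_prop

open MeasureTheory Complex in
lemma aux_kernel (ρ : ℝ) (hρ : 0 < ρ) (ω : ℂ) (hr : 0 < ω.re) :
    ∫ u : ℝ, cexp (-(ρ * ω) * Real.cosh u)
      = 2 * cexp (-(ρ * ω)) * ∫ y : ℝ, cexp (-(2 * ρ * (y:ℂ)^2)) * auxG ω y := by
  -- step 1
  have s1 : ∫ u : ℝ, cexp (-(ρ * ω) * Real.cosh u)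
      = ∫ v : ℝ, cexp (-(ρ * ω) * (1 + (v:ℂ)^2)) * (2 * (√(v^2+2))⁻¹ : ℝ) := by
    have h := integral_image_eq_integral_abs_deriv_smul (s := Set.univ)
      (f := fun u : ℝ => √2 * Real.sinh (u/2)) (f' := fun u : ℝ => √2/2 * Real.cosh (u/2))
      MeasurableSet.univ
      (by
        intro u _
        have h1 : HasDerivAt (fun u : ℝ => √2 * Real.sinh (u/2))
            (√2/2 * Real.cosh (u/2)) u := by
          have h0 : HasDerivAt (fun u : ℝ => u/2) (1/2) u := (hasDerivAt_id u).div_const 2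
          have h3 := (h0.sinh).const_mul (√2)
          refine h3.congr_deriv ?_
          ring
        exact h1.hasDerivWithinAt)
      (by
        intro a _ b _ hab
        have : Real.sinh (a/2) = Real.sinh (b/2) := by
          have h2 : (√2 : ℝ) ≠ 0 := by positivity
          exact mul_left_cancel₀ h2 hab
        have := Real.sinh_injective this
        linarith)
      (fun v : ℝ => cexp (-(ρ * ω) * (1 + (v:ℂ)^2)) * (2 * (√(v^2+2))⁻¹ : ℝ))
    have himg : (fun u : ℝ => √2 * Real.sinh (u/2)) '' Set.univ = Set.univ := by
      rw [Set.image_univ, Set.range_eq_univ]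
      intro v
      refine ⟨2 * Real.arsinh (v / √2), ?_⟩
      have h2 : (√2 : ℝ) ≠ 0 := by positivity
      simp only [mul_div_cancel_left₀ _ (two_ne_zero' ℝ), Real.sinh_arsinh]
      field_simp
    rw [himg, Measure.restrict_univ] at h
    rw [h]
    congr 1; ext u
    have hc := Real.cosh_pos (u/2)
    have hs : (√2 * Real.sinh (u/2))^2 + 2 = 2 * Real.cosh (u/2)^2 := by
      rw [mul_pow, Real.sq_sqrt (by norm_num), Real.cosh_sq]; ring
    have hs2 : √((√2 * Real.sinh (u/2))^2 + 2) = √2 * Real.cosh (u/2) := by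
      rw [hs, Real.sqrt_mul (by norm_num), Real.sqrt_sq hc.le]
    rw [hs2, abs_of_nonneg (by positivity), Complex.real_smul]
    have hch : Real.cosh u = 1 + (√2 * Real.sinh (u/2))^2 := by
      have : Real.cosh u = Real.cosh (2 * (u/2)) := by congr 1; ring
      rw [this, Real.cosh_two_mul, Real.cosh_sq, mul_pow, Real.sq_sqrt (by norm_num)]; ring
    rw [hch]
    have : ((√2/2 * Real.cosh (u/2) : ℝ) : ℂ) * ((2 * (√2 * Real.cosh (u/2))⁻¹ : ℝ) : ℂ) = 1 := by
      rw [← Complex.ofReal_mul, ← Complex.ofReal_one]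
      congr 1
      field_simp
    rw [mul_left_comm, this, mul_one]
    push_cast; rfl
  -- step 2
  have s2 : ∀ v : ℝ, ((√(v^2+2))⁻¹ : ℝ) = √ρ * (√Real.pi)⁻¹ * ∫ y : ℝ, Real.exp (-(ρ * (v^2+2)) * y^2) := by
    intro v
    rw [integral_gaussian, Real.sqrt_div Real.pi_pos.le, Real.sqrt_mul hρ.le]
    have := Real.pi_pos
    have : √(v^2+2) ≠ 0 := by positivity
    field_simp
  have s3 : ∀ v : ℝ, cexp (-(ρ * ω) * (1 + (v:ℂ)^2)) * (2 * (√(v^2+2))⁻¹ : ℝ)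
      = (2 * cexp (-(ρ*ω)) * (√ρ * (√Real.pi)⁻¹ : ℝ)) *
        ∫ y : ℝ, cexp (-(ρ * (ω + (y:ℂ)^2)) * (v:ℂ)^2) * cexp (-(2 * ρ * (y:ℂ)^2)) := by
    intro v
    rw [s2 v]
    push_cast
    rw [← integral_complex_ofReal]
    rw [mul_add, mul_one, Complex.exp_add]
    have : ∀ y : ℝ, cexp (-(ρ * (ω + (y:ℂ)^2)) * (v:ℂ)^2) * cexp (-(2 * ρ * (y:ℂ)^2))
      = cexp (-(ρ*ω) * (v:ℂ)^2) * ((Real.exp (-(ρ * (v^2+2)) * y^2) : ℝ) : ℂ) := by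
      intro y
      push_cast
      rw [← Complex.exp_add, ← Complex.exp_add]; congr 1; ring
    simp_rw [this]
    rw [integral_const_mul]
    ring
  rw [s1]
  simp_rw [s3]
  rw [integral_const_mul, integral_integral_swap]
  · have : ∀ y : ℝ, ∫ v : ℝ, cexp (-(ρ * (ω + (y:ℂ)^2)) * (v:ℂ)^2) * cexp (-(2 * ρ * (y:ℂ)^2))
      = ((√ρ)⁻¹ * √Real.pi : ℝ) * (cexp (-(2 * ρ * (y:ℂ)^2)) * auxG ω y) := by
      intro y
      rw [integral_mul_const, aux_gauss_scale ρ hρ]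
      · unfold auxG
        have : (√Real.pi : ℂ) ≠ 0 := by
          have := Real.pi_pos
          have : √Real.pi ≠ 0 := by positivity
          exact_mod_cast this
        push_cast
        field_simp
      · have : ((y:ℂ)^2) = ((y^2 : ℝ) : ℂ) := by push_cast; rfl
        rw [this, Complex.add_re, Complex.ofReal_re]; positivity
    simp_rw [this]
    rw [integral_const_mul]
    have h1 : ((√ρ * (√Real.pi)⁻¹ : ℝ):ℂ) * ((√ρ)⁻¹ * √Real.pi : ℝ) = 1 := by
      rw [← Complex.ofReal_mul, ← Complex.ofReal_one]
      congr 1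
      have := Real.pi_pos
      field_simp
    rw [← mul_assoc, mul_assoc (2 * _), h1, mul_one]
  · have hb : Integrable (fun p : ℝ × ℝ => Real.exp (-(ρ * ω.re) * p.1^2) * Real.exp (-(2*ρ) * p.2^2))
        (volume.prod volume) :=
      (integrable_exp_neg_mul_sq (by positivity)).mul_prod (integrable_exp_neg_mul_sq (by positivity))
    refine hb.mono' (by
      apply Continuous.aestronglyMeasurable
      simp only [Function.uncurry_def]
      fun_prop) (Filter.Eventually.of_forall fun p => ?_)
    simp only [Function.uncurry_def]
    rw [norm_mul, Complex.norm_exp, Complex.norm_exp]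
    have e1 : (-(ρ * (ω + (p.2:ℂ)^2)) * (p.1:ℂ)^2).re = -(ρ * (ω.re + p.2^2)) * p.1^2 := by
      have : ((p.1:ℂ)^2) = ((p.1^2 : ℝ) : ℂ) := by push_cast; rfl
      rw [this, Complex.re_mul_ofReal]
      have : ((p.2:ℂ)^2) = ((p.2^2 : ℝ) : ℂ) := by push_cast; rfl
      rw [this, Complex.neg_re, Complex.re_ofReal_mul, Complex.add_re, Complex.ofReal_re]
    have e2 : (-(2 * ρ * (p.2:ℂ)^2)).re = -(2*ρ) * p.2^2 := by
      have : (-(2 * ρ * (p.2:ℂ)^2)) = ((-(2*ρ) * p.2^2 : ℝ) : ℂ) := by push_cast; ring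
      rw [this, Complex.ofReal_re]
    rw [e1, e2]
    gcongr
    nlinarith [mul_nonneg hρ.le (sq_nonneg p.2)]


open MeasureTheory in
lemma aux_J (k : ℕ) (a : ℝ) (ha : 0 < a) :
    IntegrableOn (fun x : ℝ => x^k * Real.exp (-(a*x))) (Set.Ioi 1) ∧
    ∫ x in Set.Ioi (1:ℝ), x^k * Real.exp (-(a*x)) ≤ k.factorial * (2/a)^(k+1) * Real.exp (-(a/2)) := by
  have hI : ∀ r : ℝ, 0 < r → IntegrableOn (fun x : ℝ => x^k * Real.exp (-(r*x))) (Set.Ioi 0) := by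
    intro r hr
    have := integrableOn_rpow_mul_exp_neg_mul_rpow (p := 1) (s := k) (b := r)
      (by have : (0:ℝ) ≤ k := by positivity
          linarith) one_pos hr
    simpa [Real.rpow_natCast, Real.rpow_one, neg_mul] using this
  have hsub : Set.Ioi (1:ℝ) ⊆ Set.Ioi 0 := Set.Ioi_subset_Ioi zero_le_one
  refine ⟨(hI a ha).mono_set hsub, ?_⟩
  have h2 := hI (a/2) (by positivity)
  calc ∫ x in Set.Ioi (1:ℝ), x^k * Real.exp (-(a*x))
      ≤ ∫ x in Set.Ioi (1:ℝ), (x^k * Real.exp (-(a/2*x))) * Real.exp (-(a/2)) := by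
        refine setIntegral_mono_on ((hI a ha).mono_set hsub) ((h2.mono_set hsub).mul_const _)
          measurableSet_Ioi ?_
        intro x hx
        have hx : 1 < x := hx
        rw [mul_assoc, ← Real.exp_add]
        have : 0 ≤ x^k := by positivity
        gcongr
        nlinarith
    _ = (∫ x in Set.Ioi (1:ℝ), x^k * Real.exp (-(a/2*x))) * Real.exp (-(a/2)) := by
        rw [integral_mul_const]
    _ ≤ (∫ x in Set.Ioi (0:ℝ), x^k * Real.exp (-(a/2*x))) * Real.exp (-(a/2)) := by
        refine mul_le_mul_of_nonneg_right ?_ (Real.exp_pos _).le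
        refine setIntegral_mono_set h2 ?_ hsub.eventuallyLE
        refine (ae_restrict_iff' measurableSet_Ioi).2 (Filter.Eventually.of_forall fun x hx => ?_)
        have hx : 0 < x := hx
        simp only [Pi.zero_apply]; positivity
    _ = _ := by
        have := Real.integral_rpow_mul_exp_neg_mul_Ioi (a := k + 1) (r := a/2) (by positivity) (by positivity)
        simp only [add_sub_cancel_right, Real.rpow_natCast] at this
        rw [this, Real.Gamma_nat_eq_factorial]
        rw [show ((k:ℝ)+1) = ((k+1 : ℕ) : ℝ) by push_cast; rfl, Real.rpow_natCast]
        rw [one_div_div]; ring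

open MeasureTheory in
lemma aux_intC (k : ℕ) (l : ℂ) (hl : 0 < l.re) :
    IntegrableOn (fun x : ℝ => (x:ℂ)^k * Complex.exp (-(l*x))) (Set.Ioi 1) := by
  refine Integrable.mono' (aux_J k l.re hl).1 (by
    apply Continuous.aestronglyMeasurable; fun_prop) ?_
  refine (ae_restrict_iff' measurableSet_Ioi).2 (Filter.Eventually.of_forall fun x hx => ?_)
  have hx : 1 < x := hx
  rw [norm_mul, norm_pow, Complex.norm_real, Complex.norm_exp, Real.norm_of_nonneg (by linarith)]
  simp

open MeasureTheory in
lemma aux_I (k : ℕ) (l : ℂ) (hl : 0 < l.re) :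
    ‖∫ x in Set.Ioi (1:ℝ), (x:ℂ)^(k+1) * Complex.exp (-(l*x))‖
      ≤ ‖l‖⁻¹ * (2 * (k+1).factorial * (2/l.re)^(k+1) * Real.exp (-(l.re/2))) := by
  have hl0 : l ≠ 0 := by intro h; simp [h] at hl
  have hA := aux_intC (k+1) l hl
  have hB := aux_intC k l hl
  have key : ∫ x in Set.Ioi (1:ℝ), ((x:ℂ)^(k+1) * Complex.exp (-(l*x)) -
      ((k+1)/l) * ((x:ℂ)^k * Complex.exp (-(l*x)))) = 0 - (-(1/l) * (((1:ℝ):ℂ)^(k+1) * Complex.exp (-(l*(1:ℝ))))) := by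
    refine integral_Ioi_of_hasDerivAt_of_tendsto' (f := fun x : ℝ => -(1/l) * ((x:ℂ)^(k+1) * Complex.exp (-(l*x)))) ?_ ?_ ?_
    · intro x _
      have h1 : HasDerivAt (fun x : ℂ => -(1/l) * (x^(k+1) * Complex.exp (-(l*x))))
          (-(1/l) * (((k+1 : ℕ) : ℂ) * (x:ℂ)^k * Complex.exp (-(l*x)) + (x:ℂ)^(k+1) * (Complex.exp (-(l*x)) * (-(l*1))))) (x:ℂ) := by
        have e1 : HasDerivAt (fun x : ℂ => x^(k+1)) (((k+1 : ℕ) : ℂ) * (x:ℂ)^k) (x:ℂ) := by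
          simpa using hasDerivAt_pow (k+1) (x:ℂ)
        have e2 : HasDerivAt (fun x : ℂ => Complex.exp (-(l*x))) (Complex.exp (-(l*x)) * (-(l*1))) (x:ℂ) :=
          (((hasDerivAt_id (x:ℂ)).const_mul l).neg).cexp
        exact (e1.mul e2).const_mul _
      refine (h1.comp_ofReal).congr_deriv ?_
      push_cast
      field_simp
      ring
    · exact hA.sub (hB.const_mul _)
    · have h := (tendsto_rpow_mul_exp_neg_mul_atTop_nhds_zero ((k+1 : ℕ) : ℝ) l.re hl)
      rw [tendsto_zero_iff_norm_tendsto_zero]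
      have h2 := h.const_mul ‖-(1/l)‖
      rw [mul_zero] at h2
      refine h2.congr' ?_
      filter_upwards [Filter.eventually_gt_atTop 0] with x hx
      rw [norm_mul, norm_mul, norm_pow, Complex.norm_real, Complex.norm_exp,
        Real.norm_of_nonneg hx.le, Real.rpow_natCast]
      simp
  rw [integral_sub hA (hB.const_mul _), integral_const_mul] at key
  have hJ := aux_J k l.re hl
  have hBn : ‖∫ x in Set.Ioi (1:ℝ), (x:ℂ)^k * Complex.exp (-(l*x))‖
      ≤ k.factorial * (2/l.re)^(k+1) * Real.exp (-(l.re/2)) := by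
    refine (norm_integral_le_integral_norm _).trans (le_trans (le_of_eq ?_) hJ.2)
    refine setIntegral_congr_fun measurableSet_Ioi fun x hx => ?_
    have hx : 1 < x := hx
    rw [norm_mul, norm_pow, Complex.norm_real, Complex.norm_exp, Real.norm_of_nonneg (by linarith)]
    simp
  have heq : ∫ x in Set.Ioi (1:ℝ), (x:ℂ)^(k+1) * Complex.exp (-(l*x))
      = l⁻¹ * (Complex.exp (-l) + (k+1) * ∫ x in Set.Ioi (1:ℝ), (x:ℂ)^k * Complex.exp (-(l*x))) := by
    rw [sub_eq_iff_eq_add] at key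
    rw [key]
    simp; ring
  rw [heq, norm_mul, norm_inv]
  gcongr
  refine (norm_add_le _ _).trans ?_
  rw [norm_mul, Complex.norm_exp]
  have h1 : Real.exp (-l.re) ≤ ((k+1).factorial * (2/l.re)^(k+1)) * Real.exp (-(l.re/2)) := by
    have e : Real.exp (-l.re) = Real.exp (-(l.re/2)) * Real.exp (-(l.re/2)) := by
      rw [← Real.exp_add]; congr 1; ring
    rw [e]
    gcongr
    have := Real.pow_div_factorial_le_exp (x := l.re/2) (by positivity) (k+1)
    rw [Real.exp_neg, inv_le_comm₀ (Real.exp_pos _) (by positivity)]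
    refine le_trans (le_of_eq ?_) this
    rw [mul_inv, ← inv_pow, inv_div]; ring
  have hk : ‖(k:ℂ)+1‖ = k+1 := by
    rw [show (k:ℂ)+1 = ((k+1 : ℕ) : ℂ) by push_cast; rfl, Complex.norm_natCast]; push_cast; rfl
  rw [hk]
  calc _ ≤ ((k+1).factorial * (2/l.re)^(k+1)) * Real.exp (-(l.re/2)) + (k+1) * (k.factorial * (2/l.re)^(k+1) * Real.exp (-(l.re/2))) := by
        gcongr
        simpa using h1
    _ = _ := by rw [Nat.factorial_succ]; push_cast; ring


lemma aux_rexp (s : ℝ) (hs : 0 < s) : ∃ C : ℝ, 0 < C ∧ ∀ x : ℝ, 0 < x → x^s * Real.exp (-(x/2)) ≤ C := by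
  refine ⟨(2*s)^s, by positivity, fun x hx => ?_⟩
  have h : x/(2*s) ≤ Real.exp (x/(2*s)) := by
    have := Real.add_one_le_exp (x/(2*s)); linarith
  have h2 := Real.rpow_le_rpow (by positivity) h hs.le
  rw [Real.div_rpow hx.le (by positivity), ← Real.exp_mul,
    show x/(2*s)*s = x/2 by field_simp, div_le_iff₀ (by positivity)] at h2
  rw [Real.exp_neg, ← div_eq_mul_inv, div_le_iff₀ (Real.exp_pos _)]
  linarith

lemma aux_rexp2 (e s : ℝ) (hs : 0 < s) : ∃ C : ℝ, 0 < C ∧ ∀ x A : ℝ, 0 < x → 0 < A →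
    x^(s+e) * Real.exp (-(x*A/2)) ≤ C * x^e * A^(-s) := by
  obtain ⟨C, hC, h⟩ := aux_rexp s hs
  refine ⟨C, hC, fun x A hx hA => ?_⟩
  have := h (x*A) (by positivity)
  rw [Real.mul_rpow hx.le hA.le] at this
  rw [Real.rpow_add hx, Real.rpow_neg hA.le, ← div_eq_mul_inv, le_div_iff₀ (by positivity)]
  have h3 : 0 < x^e := by positivity
  nlinarith

/-- auxiliary weight -/
noncomputable def auxW (η : ℝ) (p : ℕ × ℕ) : ℝ :=
  (p.1:ℝ)^(-((1+η)/2)) * (p.2:ℝ)^(-((1+η)/2)) * (1 + |(p.1:ℝ) - p.2|)^(-(1+η))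

lemma auxW_nonneg (η : ℝ) (p : ℕ × ℕ) : 0 ≤ auxW η p := by
  unfold auxW; positivity

lemma auxW_summable (η : ℝ) (hη : 0 < η) : Summable (auxW η) := by
  have h1 : Summable (fun n : ℕ => (n:ℝ)^(-(1+η))) := by
    rw [Real.summable_nat_rpow]; linarith
  have h2 : Summable (fun j : ℤ => (1 + |(j:ℝ)|)^(-(1+η))) := by
    have h3 : Summable (fun n : ℕ => (1 + (n:ℝ))^(-(1+η))) := by
      have := (summable_nat_add_iff 1).2 h1
      refine this.congr fun n => ?_
      push_cast; rw [add_comm]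
    apply Summable.of_nat_of_neg
    · refine h3.congr fun n => by simp
    · refine h3.congr fun n => by simp
  have h4 : Summable (fun q : ℕ × ℤ => (q.1:ℝ)^(-(1+η)) * (1 + |(q.2:ℝ)|)^(-(1+η))) :=
    h1.mul_of_nonneg h2 (fun n => by positivity) (fun n => by positivity)
  have hA : Summable (fun p : ℕ × ℕ => (p.1:ℝ)^(-(1+η)) * (1 + |(p.1:ℝ) - p.2|)^(-(1+η))) := by
    have := h4.comp_injective (i := fun p : ℕ × ℕ => ((p.1, (p.1:ℤ) - p.2) : ℕ × ℤ)) (by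
      rintro ⟨a, b⟩ ⟨c, d⟩ h
      simp only [Prod.mk.injEq] at h ⊢
      omega)
    refine this.congr fun p => by simp
  have hB : Summable (fun p : ℕ × ℕ => (p.2:ℝ)^(-(1+η)) * (1 + |(p.1:ℝ) - p.2|)^(-(1+η))) := by
    have := h4.comp_injective (i := fun p : ℕ × ℕ => ((p.2, (p.1:ℤ) - p.2) : ℕ × ℤ)) (by
      rintro ⟨a, b⟩ ⟨c, d⟩ h
      simp only [Prod.mk.injEq] at h ⊢
      omega)
    refine this.congr fun p => by simp
  refine Summable.of_nonneg_of_le (auxW_nonneg η) (fun p => ?_) (hA.add hB)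
  unfold auxW
  rw [← add_mul]
  gcongr
  have e : ∀ n : ℕ, (n:ℝ)^(-(1+η)) = ((n:ℝ)^(-((1+η)/2)))^2 := by
    intro n
    rw [← Real.rpow_natCast, ← Real.rpow_mul (by positivity)]
    congr 1; push_cast; ring
  rw [e, e]
  nlinarith [sq_nonneg ((p.1:ℝ)^(-((1+η)/2)) - (p.2:ℝ)^(-((1+η)/2))), sq_nonneg ((p.1:ℝ)^(-((1+η)/2))), sq_nonneg ((p.2:ℝ)^(-((1+η)/2)))]

lemma aux_term (η : ℝ) (hη : 0 < η) (K : ℕ) (hK : 2 ≤ K) : ∃ C : ℝ, 0 < C ∧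
    ∀ A L : ℝ, 0 < A → ∀ M N : ℕ, 1 ≤ M → 1 ≤ N → (M+N)*A ≤ L → |(M:ℝ)-N|/2 ≤ L →
      ((M:ℝ)^(1+η) * (N:ℝ)^(1+η)) * (L⁻¹ * ((2/((M+N)*A))^K * Real.exp (-((M+N)*A/2))))
        ≤ C * A^(-(K+1+5*η)) * auxW η (M,N) := by
  obtain ⟨C1, hC1, h1⟩ := aux_rexp2 (-((1+η)/2)) ((1+5*η)/2) (by positivity)
  obtain ⟨C2, hC2, h2⟩ := aux_rexp2 0 (5*η/2) (by positivity)
  refine ⟨2^K * (4 * C1^2 + C2^2), by positivity, ?_⟩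
  intro A L hA M N hM hN hL1 hL2
  have hM' : (1:ℝ) ≤ M := by exact_mod_cast hM
  have hN' : (1:ℝ) ≤ N := by exact_mod_cast hN
  have hM0 : (0:ℝ) < M := by linarith
  have hN0 : (0:ℝ) < N := by linarith
  have hL : 0 < L := lt_of_lt_of_le (by positivity) hL1
  have hpow : (2/(((M:ℝ)+N)*A))^K ≤ 2^K * (A^K)⁻¹ * ((M:ℝ)*N)⁻¹ := by
    rw [div_pow, mul_pow, div_eq_mul_inv, mul_inv, mul_assoc, mul_comm (A^K)⁻¹]
    gcongr
    calc (M:ℝ)*N ≤ (M+N)^2 := by nlinarith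
      _ ≤ (M+N)^K := pow_le_pow_right₀ (by linarith) hK
  have hexp : Real.exp (-(((M:ℝ)+N)*A/2)) = Real.exp (-(M*A/2)) * Real.exp (-(N*A/2)) := by
    rw [← Real.exp_add]; congr 1; ring
  have step1 : ((M:ℝ)^(1+η) * (N:ℝ)^(1+η)) * (L⁻¹ * ((2/((M+N)*A))^K * Real.exp (-((M+N)*A/2))))
      ≤ 2^K * (A^K)⁻¹ * (L⁻¹ * ((M:ℝ)^η * (N:ℝ)^η * (Real.exp (-(M*A/2)) * Real.exp (-(N*A/2))))) := by
    rw [hexp]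
    calc _ ≤ ((M:ℝ)^(1+η) * (N:ℝ)^(1+η)) * (L⁻¹ * ((2^K * (A^K)⁻¹ * ((M:ℝ)*N)⁻¹) * (Real.exp (-(M*A/2)) * Real.exp (-(N*A/2))))) := by
          gcongr
      _ = _ := by
          rw [Real.rpow_add hM0, Real.rpow_add hN0, Real.rpow_one, Real.rpow_one]
          field_simp
  refine step1.trans ?_
  have hApow : A^(-(K+1+5*η)) = (A^K)⁻¹ * A^(-(1+5*η)) := by
    rw [← Real.rpow_natCast, ← Real.rpow_neg hA.le, ← Real.rpow_add hA]; congr 1; ring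
  rw [hApow]
  have step2 : L⁻¹ * ((M:ℝ)^η * (N:ℝ)^η * (Real.exp (-(M*A/2)) * Real.exp (-(N*A/2))))
      ≤ (4 * C1^2 + C2^2) * A^(-(1+5*η)) * auxW η (M,N) := by
    by_cases hMN : M = N
    · subst hMN
      have hw : auxW η (M,M) = (M:ℝ)^(-(1+η)) := by
        unfold auxW
        simp only [sub_self, abs_zero, add_zero, Real.one_rpow, mul_one]
        rw [← Real.rpow_add hM0]; congr 1; ring
      rw [hw]
      have hLi : L⁻¹ ≤ (M:ℝ)⁻¹ * A⁻¹ := by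
        rw [← mul_inv]; gcongr; nlinarith
      have h3 := h2 M A hM0 hA
      simp only [add_zero, Real.rpow_zero, mul_one] at h3
      have h4 : (M:ℝ)^(3*η/2) * Real.exp (-(M*A/2)) ≤ C2 * A^(-(5*η/2)) := by
        refine le_trans ?_ h3
        gcongr <;> linarith
      have h5 : ((M:ℝ)^(3*η/2) * Real.exp (-(M*A/2)))^2 ≤ (C2 * A^(-(5*η/2)))^2 := by gcongr
      have e1 : (A^(-(5*η/2)))^2 * A⁻¹ = A^(-(1+5*η)) := by
        rw [← Real.rpow_natCast, ← Real.rpow_mul hA.le, ← Real.rpow_neg_one A, ← Real.rpow_add hA]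
        congr 1; push_cast; ring
      have e2 : (M:ℝ)⁻¹ * ((M:ℝ)^η * (M:ℝ)^η) = (M:ℝ)^(-(1+η)) * ((M:ℝ)^(3*η/2))^2 := by
        rw [← Real.rpow_natCast, ← Real.rpow_mul hM0.le, ← Real.rpow_neg_one (M:ℝ), ← Real.rpow_add hM0,
          ← Real.rpow_add hM0, ← Real.rpow_add hM0]
        congr 1; push_cast; ring
      calc _ ≤ ((M:ℝ)⁻¹ * A⁻¹) * ((M:ℝ)^η * (M:ℝ)^η * (Real.exp (-(M*A/2)) * Real.exp (-(M*A/2)))) := by gcongr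
        _ = ((M:ℝ)⁻¹ * ((M:ℝ)^η * (M:ℝ)^η)) * A⁻¹ * (Real.exp (-(M*A/2)))^2 := by ring
        _ = (M:ℝ)^(-(1+η)) * A⁻¹ * ((M:ℝ)^(3*η/2) * Real.exp (-(M*A/2)))^2 := by rw [e2]; ring
        _ ≤ (M:ℝ)^(-(1+η)) * A⁻¹ * (C2 * A^(-(5*η/2)))^2 := by gcongr
        _ = C2^2 * A^(-(1+5*η)) * (M:ℝ)^(-(1+η)) := by rw [← e1]; ring
        _ ≤ _ := by
          gcongr; nlinarith [sq_nonneg C1]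
    · have habs : 1 ≤ |(M:ℝ)-N| := by
        have : (1:ℤ) ≤ |(M:ℤ)-N| := Int.one_le_abs (by omega)
        exact_mod_cast this
      have hle : 1 + |(M:ℝ)-N| ≤ M*N := by
        rcases le_total (M:ℝ) N with h | h
        · rw [abs_of_nonpos (by linarith)]; nlinarith
        · rw [abs_of_nonneg (by linarith)]; nlinarith
      set D := 1 + |(M:ℝ)-N| with hD
      have hD0 : 0 < D := by positivity
      have hLi : L⁻¹ ≤ 4 * (D^(-(1+η)) * ((M:ℝ)^η*(N:ℝ)^η)) := by
        calc L⁻¹ ≤ (D/4)⁻¹ := by gcongr; linarith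
          _ = 4 * (D^(-(1+η)) * D^η) := by
            rw [← Real.rpow_add hD0, show -(1+η)+η = -1 by ring, Real.rpow_neg_one]; field_simp
          _ ≤ _ := by
            rw [← Real.mul_rpow hM0.le hN0.le]; gcongr
      have hM3 := h1 M A hM0 hA
      have hN3 := h1 N A hN0 hA
      rw [show (1+5*η)/2 + -((1+η)/2) = 2*η by ring] at hM3 hN3
      have e1 : ∀ x : ℝ, 0 < x → x^(2*η) = x^η*x^η := by
        intro x hx; rw [← Real.rpow_add hx]; congr 1; ring
      rw [e1 _ hM0] at hM3
      rw [e1 _ hN0] at hN3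
      have e2 : A^(-((1+5*η)/2)) * A^(-((1+5*η)/2)) = A^(-(1+5*η)) := by
        rw [← Real.rpow_add hA]; congr 1; ring
      calc _ ≤ (4 * (D^(-(1+η)) * ((M:ℝ)^η*(N:ℝ)^η))) * ((M:ℝ)^η * (N:ℝ)^η * (Real.exp (-(M*A/2)) * Real.exp (-(N*A/2)))) := by gcongr
        _ = 4 * D^(-(1+η)) * ((M:ℝ)^η * (M:ℝ)^η * Real.exp (-(M*A/2))) * ((N:ℝ)^η * (N:ℝ)^η * Real.exp (-(N*A/2))) := by ring
        _ ≤ 4 * D^(-(1+η)) * (C1 * (M:ℝ)^(-((1+η)/2)) * A^(-((1+5*η)/2))) * (C1 * (N:ℝ)^(-((1+η)/2)) * A^(-((1+5*η)/2))) := by gcongr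
        _ = 4 * C1^2 * A^(-(1+5*η)) * auxW η (M,N) := by
          unfold auxW; rw [← e2, ← hD]; ring
        _ ≤ _ := by
          have := auxW_nonneg η (M,N)
          gcongr; nlinarith [sq_nonneg C2]
  calc _ ≤ 2^K * (A^K)⁻¹ * ((4 * C1^2 + C2^2) * A^(-(1+5*η)) * auxW η (M,N)) := by gcongr
    _ = _ := by ring


lemma aux_b_summable (η B : ℝ) (hη : 0 < η) (b : ℕ → ℂ)
    (hb : ∀ N : ℕ, ‖b N‖ ≤ B * (N:ℝ)^(1+η)) (a : ℝ) (ha : 0 < a) :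
    Summable (fun N : ℕ => ‖b N‖ * Real.exp (-(N*a))) := by
  obtain ⟨C, hC, h⟩ := aux_rexp2 (-2) (3+η) (by positivity)
  have hs : Summable (fun N : ℕ => |B| * (C * (N:ℝ)^(-2:ℝ) * (2*a)^(-(3+η)))) := by
    apply Summable.mul_left
    apply Summable.mul_right
    apply Summable.mul_left
    rw [Real.summable_nat_rpow]; norm_num
  refine Summable.of_nonneg_of_le (fun N => by positivity) (fun N => ?_) hs
  by_cases hN : N = 0
  · have h0 := hb N
    subst hN
    rw [Nat.cast_zero, Real.zero_rpow (by linarith), mul_zero] at h0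
    have : ‖b 0‖ = 0 := le_antisymm h0 (norm_nonneg _)
    rw [this, zero_mul]; positivity
  · have hN0 : (0:ℝ) < N := by positivity
    have h1 := h N (2*a) hN0 (by positivity)
    rw [show 3+η+-2 = 1+η by ring, show (N:ℝ)*(2*a)/2 = N*a by ring] at h1
    calc ‖b N‖ * Real.exp (-(N*a)) ≤ (|B| * (N:ℝ)^(1+η)) * Real.exp (-(N*a)) := by
          gcongr
          exact (hb N).trans (by gcongr; exact le_abs_self B)
      _ = |B| * ((N:ℝ)^(1+η) * Real.exp (-(N*a))) := by ring
      _ ≤ _ := by gcongr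

open MeasureTheory in
lemma aux_meansq (η B : ℝ) (hη : 0 < η) (hB : 0 < B) (K : ℕ) (hK : 2 ≤ K) : ∃ C : ℝ, 0 < C ∧
    ∀ b : ℕ → ℂ, (∀ N : ℕ, ‖b N‖ ≤ B * (N:ℝ)^(1+η)) → ∀ z : ℂ, 0 < z.re → 1/2 ≤ |z.im| →
      IntegrableOn (fun x : ℝ => x^K * ‖∑' N : ℕ, b N * Complex.exp (-(N*z*x))‖^2) (Set.Ioi 1) ∧
      ∫ x in Set.Ioi (1:ℝ), x^K * ‖∑' N : ℕ, b N * Complex.exp (-(N*z*x))‖^2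
        ≤ C * z.re^(-(K+1+5*η)) := by
  obtain ⟨C0, hC0, hterm⟩ := aux_term η hη K hK
  have hW := auxW_summable η hη
  refine ⟨B^2 * (2 * K.factorial) * C0 * (1 + ∑' p, auxW η p), by
    have : 0 ≤ ∑' p, auxW η p := tsum_nonneg (auxW_nonneg η)
    positivity, ?_⟩
  intro b hb z hz hzi
  set A := z.re with hA
  have hb0 : b 0 = 0 := by
    have h0 := hb 0
    rw [Nat.cast_zero, Real.zero_rpow (by linarith), mul_zero] at h0
    exact norm_le_zero_iff.1 h0
  have hre : ∀ (N : ℕ) (x : ℝ), (-(N*z*x)).re = -(N*A*x) := by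
    intro N x; simp [hA]
  have hnorm : ∀ (N : ℕ) (x : ℝ), ‖b N * Complex.exp (-(N*z*x))‖ = ‖b N‖ * Real.exp (-(N*A*x)) := by
    intro N x; rw [norm_mul, Complex.norm_exp, hre]
  have hsum : ∀ x : ℝ, 0 < x → Summable (fun N : ℕ => ‖b N * Complex.exp (-(N*z*x))‖) := by
    intro x hx
    refine (aux_b_summable η B hη b hb (A*x) (by positivity)).congr fun N => ?_
    rw [hnorm]; congr 2; ring
  set F : ℝ → ℂ := fun x => ∑' N : ℕ, b N * Complex.exp (-(N*z*x)) with hF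
  have hFc : ContinuousOn F (Set.Ioi 1) := by
    refine continuousOn_tsum (u := fun N : ℕ => ‖b N‖ * Real.exp (-(N*A))) (fun N => by fun_prop)
      (aux_b_summable η B hη b hb A hz) ?_
    intro N x hx
    have hx : 1 < x := hx
    rw [hnorm]
    have : 0 ≤ (N:ℝ)*A := by positivity
    refine mul_le_mul_of_nonneg_left (Real.exp_le_exp.2 ?_) (norm_nonneg _)
    nlinarith
  set S := ∑' N : ℕ, ‖b N‖ * Real.exp (-(N*(A/2))) with hS
  have hSs := aux_b_summable η B hη b hb (A/2) (by positivity)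
  have hFb : ∀ x : ℝ, 1 < x → ‖F x‖ ≤ S * Real.exp (-(A/2*x)) := by
    intro x hx
    refine (norm_tsum_le_tsum_norm (hsum x (by linarith))).trans ?_
    rw [hS, ← tsum_mul_right]
    refine (hsum x (by linarith)).tsum_le_tsum (fun N => ?_) (hSs.mul_right _)
    rw [hnorm]
    by_cases hN : N = 0
    · subst hN; rw [hb0]; simp
    · have hN0 : (1:ℝ) ≤ N := by exact_mod_cast Nat.one_le_iff_ne_zero.2 hN
      rw [mul_assoc ‖b N‖, ← Real.exp_add]
      refine mul_le_mul_of_nonneg_left (Real.exp_le_exp.2 ?_) (norm_nonneg _)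
      nlinarith [mul_nonneg (mul_nonneg (by linarith : (0:ℝ) ≤ N) hz.le) (by linarith : (0:ℝ) ≤ x - 1), mul_nonneg (mul_nonneg (by linarith : (0:ℝ) ≤ N - 1) hz.le) (by linarith : (0:ℝ) ≤ x)]
  have hint : IntegrableOn (fun x : ℝ => x^K * ‖F x‖^2) (Set.Ioi 1) := by
    refine Integrable.mono' ((aux_J K A hz).1.const_mul (S^2)) ?_ ?_
    · refine ContinuousOn.aestronglyMeasurable ?_ measurableSet_Ioi
      exact (by fun_prop : ContinuousOn (fun x : ℝ => x^K) (Set.Ioi 1)).mul (hFc.norm.pow 2)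
    · refine (ae_restrict_iff' measurableSet_Ioi).2 (Filter.Eventually.of_forall fun x hx => ?_)
      have hx : 1 < x := hx
      rw [Real.norm_of_nonneg (by positivity)]
      have h1 := hFb x hx
      have e : Real.exp (-(A*x)) = Real.exp (-(A/2*x))^2 := by
        rw [← Real.exp_nat_mul]; congr 1; push_cast; ring
      rw [e]
      calc x^K * ‖F x‖^2 ≤ x^K * (S * Real.exp (-(A/2*x)))^2 := by gcongr
        _ = _ := by ring
  refine ⟨hint, ?_⟩
  set l : ℕ × ℕ → ℂ := fun p => p.1 * z + p.2 * (starRingEnd ℂ) z with hl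
  have hlre : ∀ p : ℕ × ℕ, (l p).re = (p.1 + p.2) * A := by
    intro p; simp [hl, hA]; ring
  have hlim : ∀ p : ℕ × ℕ, (l p).im = (p.1 - p.2) * z.im := by
    intro p; simp [hl]; ring
  set G : ℕ × ℕ → ℝ → ℂ := fun p x => b p.1 * (starRingEnd ℂ) (b p.2) * ((x:ℂ)^K * Complex.exp (-(l p * x))) with hG
  have hGsum : ∀ x : ℝ, 1 < x → ((x^K * ‖F x‖^2 : ℝ) : ℂ) = ∑' p, G p x := by
    intro x hx
    have hs1 := hsum x (by linarith)
    have hs2 : Summable (fun N : ℕ => ‖(starRingEnd ℂ) (b N * Complex.exp (-(N*z*x)))‖) := by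
      simpa only [RCLike.norm_conj] using hs1
    have h1 := tsum_mul_tsum_of_summable_norm hs1 hs2
    push_cast
    rw [← Complex.mul_conj', hF]
    simp only
    rw [Complex.conj_tsum, h1, ← tsum_mul_left]
    congr 1; ext p
    simp only [hG, hl]
    rw [map_mul, ← Complex.exp_conj]
    have e : Complex.exp (-((p.1 * z + p.2 * (starRingEnd ℂ) z) * x)) =
      Complex.exp (-(p.1*z*x)) * Complex.exp ((starRingEnd ℂ) (-(p.2*z*x))) := by
      rw [← Complex.exp_add]; congr 1; simp; ring
    rw [e]; ring
  have hlpos : ∀ p : ℕ × ℕ, p.1 ≠ 0 → p.2 ≠ 0 → 0 < (l p).re := by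
    intro p h1 h2; rw [hlre]; positivity
  have hG0 : ∀ p : ℕ × ℕ, (p.1 = 0 ∨ p.2 = 0) → G p = 0 := by
    rintro ⟨m, n⟩ h; ext x; simp only [hG]
    rcases h with h | h <;> · simp only at h; rw [h, hb0]; simp
  have hGint : ∀ p, IntegrableOn (G p) (Set.Ioi 1) := by
    intro p
    by_cases h1 : p.1 = 0
    · rw [hG0 p (Or.inl h1)]; exact integrableOn_zero
    by_cases h2 : p.2 = 0
    · rw [hG0 p (Or.inr h2)]; exact integrableOn_zero
    exact (aux_intC K (l p) (hlpos p h1 h2)).const_mul _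
  have hGnorm : Summable (fun p => ∫ x in Set.Ioi (1:ℝ), ‖G p x‖) := by
    have hp : Summable (fun p : ℕ × ℕ => (K.factorial * (2/A)^(K+1)) * ((‖b p.1‖ * Real.exp (-(p.1*(A/2)))) * (‖b p.2‖ * Real.exp (-(p.2*(A/2)))))) :=
      (hSs.mul_of_nonneg hSs (fun N => by positivity) (fun N => by positivity)).mul_left _
    refine Summable.of_nonneg_of_le (fun p => integral_nonneg fun x => norm_nonneg _) (fun p => ?_) hp
    by_cases h12 : p.1 = 0 ∨ p.2 = 0
    · rw [hG0 p h12]; simp only [Pi.zero_apply, norm_zero, integral_zero]; positivity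
    push Not at h12
    have hpos := hlpos p h12.1 h12.2
    have hJ := (aux_J K (l p).re hpos).2
    have e : ∫ x in Set.Ioi (1:ℝ), ‖G p x‖ = (‖b p.1‖ * ‖b p.2‖) * ∫ x in Set.Ioi (1:ℝ), x^K * Real.exp (-((l p).re*x)) := by
      rw [← integral_const_mul]
      refine setIntegral_congr_fun measurableSet_Ioi fun x hx => ?_
      have hx : 1 < x := hx
      simp only [hG]
      rw [norm_mul, norm_mul, norm_mul, norm_pow, Complex.norm_real, Complex.norm_exp, RCLike.norm_conj, Real.norm_of_nonneg (by linarith)]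
      simp
    rw [e]
    have hge : A ≤ (l p).re := by
      rw [hlre]
      have : (1:ℝ) ≤ p.1 := by exact_mod_cast Nat.one_le_iff_ne_zero.2 h12.1
      have : (0:ℝ) ≤ p.2 := by positivity
      nlinarith
    calc _ ≤ (‖b p.1‖ * ‖b p.2‖) * (K.factorial * (2/A)^(K+1) * Real.exp (-((l p).re/2))) := by
          gcongr
          refine hJ.trans ?_
          gcongr
      _ = _ := by
          have : Real.exp (-((l p).re/2)) = Real.exp (-(p.1*(A/2))) * Real.exp (-(p.2*(A/2))) := by
            rw [← Real.exp_add, hlre]; congr 1; ring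
          rw [this]; ring
  have hHS := hasSum_integral_of_summable_integral_norm hGint hGnorm
  have hcongr : ∫ x in Set.Ioi (1:ℝ), ∑' p, G p x = ((∫ x in Set.Ioi (1:ℝ), x^K * ‖F x‖^2 : ℝ) : ℂ) := by
    rw [← integral_complex_ofReal]
    exact setIntegral_congr_fun measurableSet_Ioi fun x hx => (hGsum x hx).symm
  rw [hcongr] at hHS
  have hbound : ∀ p, ‖∫ x in Set.Ioi (1:ℝ), G p x‖ ≤ (B^2 * (2 * K.factorial) * C0 * A^(-(K+1+5*η))) * auxW η p := by
    intro p
    have hw := auxW_nonneg η p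
    by_cases h12 : p.1 = 0 ∨ p.2 = 0
    · rw [hG0 p h12]; simp only [Pi.zero_apply, integral_zero, norm_zero]; positivity
    push Not at h12
    have hpos := hlpos p h12.1 h12.2
    obtain ⟨k, rfl⟩ : ∃ k, K = k+1 := ⟨K-1, by omega⟩
    have hI := aux_I k (l p) hpos
    have ht := hterm A ‖l p‖ hz p.1 p.2 (Nat.one_le_iff_ne_zero.2 h12.1) (Nat.one_le_iff_ne_zero.2 h12.2)
      (by rw [← hlre]; exact Complex.re_le_norm _) (by
        refine le_trans ?_ (Complex.abs_im_le_norm _)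
        rw [hlim, abs_mul]
        have := abs_nonneg ((p.1:ℝ) - p.2)
        nlinarith)
    simp only [hG]
    rw [integral_const_mul, norm_mul, norm_mul, RCLike.norm_conj]
    rw [hlre] at hI
    calc _ ≤ (B * (p.1:ℝ)^(1+η)) * (B * (p.2:ℝ)^(1+η)) * (‖l p‖⁻¹ * (2 * (k+1).factorial * (2/((p.1+p.2)*A))^(k+1) * Real.exp (-((p.1+p.2)*A/2)))) := by
          gcongr
          · exact hb _
          · exact hb _
      _ = B^2 * (2 * (k+1).factorial) * (((p.1:ℝ)^(1+η) * (p.2:ℝ)^(1+η)) * (‖l p‖⁻¹ * ((2/((p.1+p.2)*A))^(k+1) * Real.exp (-((p.1+p.2)*A/2))))) := by ring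
      _ ≤ B^2 * (2 * (k+1).factorial) * (C0 * A^(-(((k+1 : ℕ):ℝ)+1+5*η)) * auxW η p) := by gcongr
      _ = _ := by ring
  have hfin := tsum_of_norm_bounded ((hW.mul_left (B^2 * (2 * K.factorial) * C0 * A^(-(K+1+5*η)))).hasSum) hbound
  rw [hHS.tsum_eq, Complex.norm_real, tsum_mul_left] at hfin
  refine (le_abs_self _).trans (hfin.trans ?_)
  have : 0 ≤ A^(-(K+1+5*η)) := by positivity
  have h3 : 0 ≤ B^2 * (2 * K.factorial) * C0 := by positivity
  nlinarith [mul_nonneg h3 this]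


/-- auxiliary character -/
noncomputable def auxch (n : ℕ) : ℂ := ((ZMod.χ₄ (n : ZMod 4) : ℤ) : ℂ)

lemma auxch_norm (n : ℕ) : ‖auxch n‖ ≤ 1 := by
  unfold auxch
  generalize (n : ZMod 4) = a
  revert a
  have : ∀ a : ZMod 4, ZMod.χ₄ a = 0 ∨ ZMod.χ₄ a = 1 ∨ ZMod.χ₄ a = -1 := by decide
  intro a
  rcases this a with h | h | h <;> rw [h] <;> simp

lemma auxch_mul (m n : ℕ) : auxch (m*n) = auxch m * auxch n := by
  unfold auxch; push_cast; rw [map_mul]; push_cast; rfl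

lemma auxch_conj (n : ℕ) : (starRingEnd ℂ) (auxch n) = auxch n := by
  unfold auxch; simp

/-- auxiliary theta term -/
noncomputable def auxθt (n : ℕ) (z : ℂ) : ℂ :=
  n * auxch n * Complex.exp (-(Real.pi/4 * (n:ℂ)^2 * z))

/-- auxiliary theta -/
noncomputable def auxθ (z : ℂ) : ℂ := ∑' n : ℕ, auxθt n z

lemma auxθt_norm_eq (n : ℕ) (z : ℂ) : ‖auxθt n z‖ ≤ n * Real.exp (-(Real.pi/4 * (n:ℝ)^2 * z.re)) := by
  unfold auxθt
  rw [norm_mul, norm_mul, Complex.norm_natCast, Complex.norm_exp]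
  have : (-(Real.pi/4 * (n:ℂ)^2 * z)).re = -(Real.pi/4 * (n:ℝ)^2 * z.re) := by
    rw [show (Real.pi/4 * (n:ℂ)^2 * z : ℂ) = ((Real.pi/4 * (n:ℝ)^2 : ℝ):ℂ) * z by push_cast; rfl,
      Complex.neg_re, Complex.re_ofReal_mul]
  rw [this]
  gcongr
  exact mul_le_of_le_one_right (by positivity) (auxch_norm n)

lemma aux_exp_bd (n : ℕ) (r : ℝ) (hr : 0 < r) :
    (n:ℝ) * Real.exp (-(Real.pi/4 * (n:ℝ)^2 * r)) ≤ 48 * (r^3)⁻¹ * (1/(n:ℝ)^2) := by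
  rcases Nat.eq_zero_or_pos n with rfl | hn
  · simp
  have hn1 : (1:ℝ) ≤ n := by exact_mod_cast hn
  have hpi := Real.pi_gt_three
  set x := Real.pi/4 * (n:ℝ)^2 * r with hx
  have hx2 : (n:ℝ)^2 * r / 2 ≤ x := by
    rw [hx]
    have : 0 < (n:ℝ)^2 * r := by positivity
    nlinarith
  have h := Real.pow_div_factorial_le_exp (x := x) (by positivity) 3
  have h2 : ((n:ℝ)^2 * r/2)^3/6 ≤ Real.exp x := by
    refine le_trans ?_ h
    norm_num [Nat.factorial]
    gcongr
  rw [Real.exp_neg, ← div_eq_mul_inv, div_le_iff₀ (Real.exp_pos _)]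
  have h3 : 48 * (r^3)⁻¹ * (1/(n:ℝ)^2) * (((n:ℝ)^2 * r/2)^3/6) = (n:ℝ)^4 := by
    field_simp; norm_num
  calc (n:ℝ) ≤ (n:ℝ)^4 := le_self_pow₀ hn1 (by norm_num)
    _ = _ := h3.symm
    _ ≤ _ := by gcongr

lemma auxθt_norm_le (n : ℕ) (z : ℂ) (r : ℝ) (hr : 0 < r) (hz : r ≤ z.re) :
    ‖auxθt n z‖ ≤ 48 * (r^3)⁻¹ * (1/(n:ℝ)^2) := by
  refine (auxθt_norm_eq n z).trans (le_trans ?_ (aux_exp_bd n r hr))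
  gcongr

lemma aux_sum_sq : Summable (fun n : ℕ => 1/(n:ℝ)^2) := Real.summable_one_div_nat_pow.2 (by norm_num)

lemma auxθ_summable (z : ℂ) (hz : 0 < z.re) : Summable (fun n => ‖auxθt n z‖) :=
  Summable.of_nonneg_of_le (fun _ => norm_nonneg _) (fun n => auxθt_norm_le n z z.re hz le_rfl)
    (aux_sum_sq.mul_left _)

lemma auxθ_norm_le : ∃ C : ℝ, 0 < C ∧ ∀ z : ℂ, 0 < z.re → ‖auxθ z‖ ≤ C * (z.re^3)⁻¹ := by
  refine ⟨48 * (1 + ∑' n : ℕ, 1/(n:ℝ)^2), ?_, ?_⟩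
  · have : 0 ≤ ∑' n : ℕ, 1/(n:ℝ)^2 := tsum_nonneg fun n => by positivity
    positivity
  · intro z hz
    have := tsum_of_norm_bounded ((aux_sum_sq.mul_left (48 * (z.re^3)⁻¹)).hasSum)
      (fun n => auxθt_norm_le n z z.re hz le_rfl)
    rw [tsum_mul_left] at this
    refine this.trans ?_
    have : 0 ≤ (z.re^3)⁻¹ := by positivity
    nlinarith

lemma auxθ_differentiableAt (z : ℂ) (hz : 0 < z.re) : DifferentiableAt ℂ auxθ z := by
  have ho : IsOpen {w : ℂ | z.re/2 < w.re} := isOpen_lt continuous_const Complex.continuous_re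
  have := Complex.differentiableOn_tsum_of_summable_norm (F := auxθt)
    (aux_sum_sq.mul_left (48 * ((z.re/2)^3)⁻¹)) (fun n => by
      unfold auxθt; fun_prop) ho (fun n w hw => auxθt_norm_le n w (z.re/2) (by positivity) (le_of_lt hw))
  exact this.differentiableAt (ho.mem_nhds (by simp only [Set.mem_ofPred_eq]; linarith))

lemma auxθ_conj (z : ℂ) : auxθ ((starRingEnd ℂ) z) = (starRingEnd ℂ) (auxθ z) := by
  unfold auxθ
  rw [Complex.conj_tsum]
  congr 1; ext n
  unfold auxθt
  rw [map_mul, map_mul, auxch_conj, ← Complex.exp_conj]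
  have h4 : (starRingEnd ℂ) 4 = 4 := Complex.conj_ofNat 4
  simp [h4]

lemma aux_sin (n : ℕ) : ((Real.sin (2*Real.pi*(1/4)*n) : ℝ) : ℂ) = auxch n := by
  unfold auxch
  have key : ∀ k r : ℕ, Real.sin (2*Real.pi*(1/4)*((4*k+r : ℕ) : ℝ)) = Real.sin (Real.pi/2*r) := by
    intro k r
    rw [show 2*Real.pi*(1/4)*((4*k+r : ℕ) : ℝ) = Real.pi/2*r + k*(2*Real.pi) by push_cast; ring]
    exact Real.sin_add_nat_mul_two_pi _ _
  have hn : n = 4*(n/4) + n%4 := by omega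
  have hlt : n%4 < 4 := Nat.mod_lt _ (by norm_num)
  have hc : ((n : ℕ) : ZMod 4) = ((n%4 : ℕ) : ZMod 4) := by simp
  rw [hc]
  conv_lhs => rw [hn]
  rw [key]
  generalize n%4 = r at hlt
  interval_cases r
  · simp
  · simp
  · rw [show Real.pi/2*((2:ℕ):ℝ) = Real.pi by push_cast; ring, Real.sin_pi,
      show ZMod.χ₄ ((2:ℕ) : ZMod 4) = 0 by decide]; simp
  · rw [show Real.pi/2*((3:ℕ):ℝ) = Real.pi/2 + Real.pi by push_cast; ring, Real.sin_add_pi,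
      Real.sin_pi_div_two, show ZMod.χ₄ ((3:ℕ) : ZMod 4) = -1 by decide]; simp

lemma auxθ_eq_sin (p : ℝ) (hp : 0 < p) : ((HurwitzZeta.sinKernel ((1/4 : ℝ) : UnitAddCircle) (p/4) : ℝ) : ℂ) = 2 * auxθ p := by
  have h := HurwitzZeta.hasSum_nat_sinKernel (1/4) (t := p/4) (by positivity)
  rw [← Complex.hasSum_ofReal] at h
  rw [← h.tsum_eq, auxθ, ← tsum_mul_left]
  congr 1; ext n
  rw [auxθt, ← aux_sin]
  push_cast
  rw [show (-(Real.pi/4*(n:ℂ)^2*p) : ℂ) = -Real.pi*(n:ℂ)^2*(p/4) by ring]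
  ring

lemma auxθ_eq_odd (p : ℝ) (hp : 0 < p) : ((HurwitzZeta.oddKernel ((1/4 : ℝ) : UnitAddCircle) (4*p) : ℝ) : ℂ) = auxθ p / 4 := by
  have h := HurwitzZeta.hasSum_int_oddKernel (1/4) (x := 4*p) (by positivity)
  rw [← Complex.hasSum_ofReal] at h
  have h2 := h.nat_add_neg_add_one
  rw [← h2.tsum_eq]
  have hs : Summable (fun n => auxθt n p) := (auxθ_summable p (by simpa using hp)).of_norm
  rw [auxθ, Nat.sumByResidueClasses hs 4]
  have inj : ∀ j : ℕ, Function.Injective (fun m : ℕ => j + 4*m) := by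
    intro j a b hab; simp only at hab; omega
  have hs' : ∀ j : ℕ, Summable (fun m : ℕ => auxθt (j + 4*m) p) := fun j => hs.comp_injective (inj j)
  have hval : (Finset.univ : Finset (ZMod 4)) = {0,1,2,3} := by decide
  rw [hval]
  rw [Finset.sum_insert (by decide), Finset.sum_insert (by decide), Finset.sum_insert (by decide), Finset.sum_singleton]
  have v0 : (0 : ZMod 4).val = 0 := by decide
  have v1 : (1 : ZMod 4).val = 1 := by decide
  have v2 : (2 : ZMod 4).val = 2 := by decide
  have v3 : (3 : ZMod 4).val = 3 := by decide
  rw [v0, v1, v2, v3]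
  have hch : ∀ j m : ℕ, auxch (j + 4*m) = auxch j := by
    intro j m; unfold auxch
    have : ((j + 4*m : ℕ) : ZMod 4) = (j : ZMod 4) := by
      push_cast
      rw [show (4 : ZMod 4) = 0 by decide]; ring
    rw [this]
  have c0 : auxch 0 = 0 := by simp [auxch]
  have c1 : auxch 1 = 1 := by simp [auxch]
  have c2 : auxch 2 = 0 := by
    unfold auxch; rw [show ZMod.χ₄ ((2:ℕ) : ZMod 4) = 0 by decide]; simp
  have c3 : auxch 3 = -1 := by
    unfold auxch; rw [show ZMod.χ₄ ((3:ℕ) : ZMod 4) = -1 by decide]; simp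
  have z0 : ∀ m, auxθt (0 + 4*m) p = 0 := by intro m; rw [auxθt, hch, c0]; ring
  have z2 : ∀ m, auxθt (2 + 4*m) p = 0 := by intro m; rw [auxθt, hch, c2]; ring
  simp_rw [z0, z2]
  rw [tsum_zero, zero_add, zero_add, ← (hs' 1).tsum_add (hs' 3), ← tsum_div_const]
  congr 1; ext m
  rw [auxθt, auxθt, hch, hch, c1, c3]
  push_cast
  rw [show (-(Real.pi/4*(1+4*(m:ℂ))^2*p) : ℂ) = -Real.pi*((m:ℂ)+1/4)^2*(4*p) by ring,
    show (-(Real.pi/4*(3+4*(m:ℂ))^2*p) : ℂ) = -Real.pi*(-((m:ℂ)+1)+1/4)^2*(4*p) by ring]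
  ring

lemma auxθ_mod_real (p : ℝ) (hp : 0 < p) : auxθ (1/p : ℝ) = (p:ℂ)^(3/2 : ℂ) * auxθ p := by
  have h := HurwitzZeta.oddKernel_functional_equation ((1/4 : ℝ) : UnitAddCircle) (4*p)
  have h1 := auxθ_eq_odd p hp
  have h2 := auxθ_eq_sin (1/p) (by positivity)
  rw [h, show 1/(4*p) = (1/p)/4 by field_simp] at h1
  push_cast at h1
  push_cast at h2
  rw [h2] at h1
  have e : (((4*p)^(3/2 : ℝ) : ℝ) : ℂ) = 8 * (p:ℂ)^(3/2 : ℂ) := by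
    rw [Real.mul_rpow (by norm_num) hp.le, show (4:ℝ)^(3/2 : ℝ) = 8 by
      rw [show (4:ℝ) = 2^(2:ℝ) by norm_num, ← Real.rpow_mul (by norm_num)]; norm_num]
    push_cast
    rw [Complex.ofReal_cpow hp.le]; push_cast; rfl
  rw [e] at h1
  have hne : (p:ℂ)^(3/2 : ℂ) ≠ 0 := by
    rw [Complex.cpow_ne_zero_iff]; left; exact_mod_cast hp.ne'
  push_cast
  field_simp at h1
  linear_combination h1/8

lemma auxθ_mod (z : ℂ) (hz : 0 < z.re) : auxθ (1/z) = z^(3/2 : ℂ) * auxθ z := by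
  have ho : IsOpen {w : ℂ | 0 < w.re} := isOpen_lt continuous_const Complex.continuous_re
  have hinv : ∀ w : ℂ, 0 < w.re → 0 < (1/w).re := by
    intro w hw
    rw [one_div, Complex.inv_re]
    have : w ≠ 0 := by intro h; simp [h] at hw
    have := Complex.normSq_pos.2 this
    positivity
  have hA : AnalyticOnNhd ℂ (fun w => auxθ (1/w)) {w : ℂ | 0 < w.re} := by
    refine DifferentiableOn.analyticOnNhd (fun w hw => DifferentiableAt.differentiableWithinAt ?_) ho
    have h0 : w ≠ 0 := by intro h; rw [h] at hw; simp at hw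
    exact (auxθ_differentiableAt (1/w) (hinv w hw)).comp w
      ((differentiableAt_const (1:ℂ)).div differentiableAt_id h0)
  have hB : AnalyticOnNhd ℂ (fun w => w^(3/2 : ℂ) * auxθ w) {w : ℂ | 0 < w.re} := by
    refine DifferentiableOn.analyticOnNhd (fun w hw => DifferentiableAt.differentiableWithinAt ?_) ho
    refine DifferentiableAt.mul ?_ (auxθ_differentiableAt w hw)
    exact (differentiableAt_id).cpow_const (Or.inl hw)
  have hpre : IsPreconnected {w : ℂ | 0 < w.re} := (convex_halfSpace_re_gt 0).isPreconnected
  refine hA.eqOn_of_preconnected_of_frequently_eq hB hpre (z₀ := 1) (by simp) ?_ hz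
  have ht : Filter.Tendsto (fun n : ℕ => ((1 + 1/((n:ℝ)+1) : ℝ) : ℂ)) Filter.atTop (nhdsWithin 1 {1}ᶜ) := by
    rw [tendsto_nhdsWithin_iff]
    constructor
    · have h1 := (tendsto_one_div_add_atTop_nhds_zero_nat (𝕜 := ℝ)).const_add 1
      rw [add_zero] at h1
      have := (Complex.continuous_ofReal.tendsto 1).comp h1
      rw [Complex.ofReal_one] at this
      exact this
    · refine Filter.Eventually.of_forall fun n => ?_
      simp only [Set.mem_compl_iff, Set.mem_singleton_iff]
      intro h
      have h2 : (1 + 1/((n:ℝ)+1) : ℝ) = 1 := by exact_mod_cast h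
      have : 0 < 1/((n:ℝ)+1) := by positivity
      linarith
  refine ht.frequently (Filter.Eventually.frequently (Filter.Eventually.of_forall fun n => ?_))
  have := auxθ_mod_real (1 + 1/((n:ℝ)+1)) (by positivity)
  rw [← this]; push_cast; rfl


open MeasureTheory in
lemma aux_cpow_int (a : ℂ) (ha : 0 < a.re) (r : ℂ) (hr : 0 < r.re) :
    IntegrableOn (fun t : ℝ => (t:ℂ)^(a-1) * Complex.exp (-(r*t))) (Set.Ioi 0) := by
  have h := integrableOn_rpow_mul_exp_neg_mul_rpow (p := 1) (s := a.re - 1) (b := r.re)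
      (by linarith) one_pos hr
  refine Integrable.mono' h ?_ ?_
  · refine ContinuousOn.aestronglyMeasurable ?_ measurableSet_Ioi
    refine ContinuousOn.mul ?_ (by fun_prop)
    intro t ht
    refine ContinuousAt.continuousWithinAt ?_
    exact Complex.continuousAt_ofReal_cpow_const _ _ (Or.inr (ne_of_gt ht))
  · refine (ae_restrict_iff' measurableSet_Ioi).2 (Filter.Eventually.of_forall fun t ht => ?_)
    have ht : 0 < t := ht
    rw [norm_mul, Complex.norm_cpow_eq_rpow_re_of_pos ht, Complex.norm_exp]
    simp

open MeasureTheory in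
lemma aux_gamma_cplx (a : ℂ) (ha : 0 < a.re) (r : ℂ) (hr : 0 < r.re) :
    ∫ t in Set.Ioi (0:ℝ), (t:ℂ)^(a-1) * Complex.exp (-(r*t)) = r^(-a) * Complex.Gamma a := by
  have ho : IsOpen {w : ℂ | 0 < w.re} := isOpen_lt continuous_const Complex.continuous_re
  have hA : AnalyticOnNhd ℂ (fun r : ℂ => ∫ t in Set.Ioi (0:ℝ), (t:ℂ)^(a-1) * Complex.exp (-(r*t))) {w : ℂ | 0 < w.re} := by
    refine DifferentiableOn.analyticOnNhd (fun w hw => DifferentiableAt.differentiableWithinAt ?_) ho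
    have hw : 0 < w.re := hw
    have hs : {v : ℂ | w.re/2 < v.re} ∈ nhds w :=
      (isOpen_lt continuous_const Complex.continuous_re).mem_nhds (by simp only [Set.mem_ofPred_eq]; linarith)
    have hbi := integrableOn_rpow_mul_exp_neg_mul_rpow (p := 1) (s := a.re) (b := w.re/2)
      (by linarith) one_pos (by positivity)
    have hmeas : ∀ v : ℂ, 0 < v.re → AEStronglyMeasurable (fun t : ℝ => (t:ℂ)^(a-1) * (Complex.exp (-(v*t)) * (-(t:ℂ)))) (volume.restrict (Set.Ioi 0)) := by
      intro v hv
      have := (aux_cpow_int a ha v hv).aestronglyMeasurable.mul (f := _) (g := fun t : ℝ => -(t:ℂ)) (by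
        apply Continuous.aestronglyMeasurable; fun_prop)
      refine this.congr (Filter.Eventually.of_forall fun t => ?_)
      simp only [Pi.mul_apply]; ring
    have := hasDerivAt_integral_of_dominated_loc_of_deriv_le (𝕜 := ℂ) (μ := volume.restrict (Set.Ioi (0:ℝ)))
      (F := fun (r : ℂ) (t : ℝ) => (t:ℂ)^(a-1) * Complex.exp (-(r*t)))
      (F' := fun (r : ℂ) (t : ℝ) => (t:ℂ)^(a-1) * (Complex.exp (-(r*t)) * (-(t:ℂ))))
      (x₀ := w) (s := {v : ℂ | w.re/2 < v.re}) hs (bound := fun t : ℝ => t^a.re * Real.exp (-(w.re/2) * t^(1:ℝ)))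
      (by
        filter_upwards [hs] with v hv
        have hv : w.re/2 < v.re := hv
        exact (aux_cpow_int a ha v (by linarith)).aestronglyMeasurable)
      (aux_cpow_int a ha w hw) (hmeas w hw)
      (by
        refine (ae_restrict_iff' measurableSet_Ioi).2 (Filter.Eventually.of_forall fun t ht v hv => ?_)
        have ht : 0 < t := ht
        have hv : w.re/2 < v.re := hv
        rw [norm_mul, norm_mul, Complex.norm_cpow_eq_rpow_re_of_pos ht, Complex.norm_exp, norm_neg, Complex.norm_real,
          Real.norm_of_nonneg ht.le]
        have e : t^a.re = t^(a-1).re * t := by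
          rw [Complex.sub_re, Complex.one_re, Real.rpow_sub_one ht.ne']; field_simp
        rw [e]
        have : (-(v*t)).re = -v.re * t := by simp
        rw [this, Real.rpow_one]
        have : Real.exp (-v.re*t) ≤ Real.exp (-(w.re/2)*t) := by
          apply Real.exp_le_exp.2; nlinarith
        have h0 : 0 ≤ t^(a-1).re := by positivity
        calc _ = t^(a-1).re * t * Real.exp (-v.re*t) := by ring
          _ ≤ _ := by gcongr)
      hbi
      (by
        refine Filter.Eventually.of_forall fun t v _ => ?_
        have e2 : HasDerivAt (fun v : ℂ => Complex.exp (-(v*t))) (Complex.exp (-(v*t)) * (-(1*(t:ℂ)))) v :=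
          (((hasDerivAt_id v).mul_const (t:ℂ)).neg).cexp
        rw [one_mul] at e2
        exact e2.const_mul _)
    exact this.2.differentiableAt
  have hB : AnalyticOnNhd ℂ (fun r : ℂ => r^(-a) * Complex.Gamma a) {w : ℂ | 0 < w.re} := by
    refine DifferentiableOn.analyticOnNhd (fun w hw => DifferentiableAt.differentiableWithinAt ?_) ho
    exact ((differentiableAt_id).cpow_const (Or.inl hw)).mul_const _
  have hpre : IsPreconnected {w : ℂ | 0 < w.re} := (convex_halfSpace_re_gt 0).isPreconnected
  refine hA.eqOn_of_preconnected_of_frequently_eq hB hpre (z₀ := 1) (by simp) ?_ hr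
  have ht : Filter.Tendsto (fun n : ℕ => ((1 + 1/((n:ℝ)+1) : ℝ) : ℂ)) Filter.atTop (nhdsWithin 1 {1}ᶜ) := by
    rw [tendsto_nhdsWithin_iff]
    constructor
    · have h1 := (tendsto_one_div_add_atTop_nhds_zero_nat (𝕜 := ℝ)).const_add 1
      rw [add_zero] at h1
      have := (Complex.continuous_ofReal.tendsto 1).comp h1
      rw [Complex.ofReal_one] at this
      exact this
    · refine Filter.Eventually.of_forall fun n => ?_
      simp only [Set.mem_compl_iff, Set.mem_singleton_iff]
      intro h
      have h2 : (1 + 1/((n:ℝ)+1) : ℝ) = 1 := by exact_mod_cast h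
      have : 0 < 1/((n:ℝ)+1) := by positivity
      linarith
  refine ht.frequently (Filter.Eventually.frequently (Filter.Eventually.of_forall fun n => ?_))
  have hx : (0:ℝ) < 1 + 1/((n:ℝ)+1) := by positivity
  generalize (1 + 1/((n:ℝ)+1) : ℝ) = x at hx
  rw [Complex.integral_cpow_mul_exp_neg_mul_Ioi ha hx]
  congr 1
  rw [one_div, Complex.inv_cpow _ _ (by rw [Complex.arg_ofReal_of_nonneg hx.le]; exact Real.pi_pos.ne), Complex.cpow_neg]


lemma aux_cpow_pos_mul (x : ℝ) (hx : 0 < x) (ω s : ℂ) (hω : ω ≠ 0) :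
    ((x:ℂ) * ω)^s = (x:ℂ)^s * ω^s := by
  have hx' : (x:ℂ) ≠ 0 := by exact_mod_cast hx.ne'
  rw [Complex.cpow_def_of_ne_zero (mul_ne_zero hx' hω), Complex.cpow_def_of_ne_zero hx',
    Complex.cpow_def_of_ne_zero hω, Complex.log_ofReal_mul hx hω, ← Complex.exp_add,
    Complex.ofReal_log hx.le]
  congr 1; ring

lemma aux_nat_cpow (n : ℕ) (hn : n ≠ 0) (w : ℂ) :
    (n:ℂ) * ((Real.pi/4 * (n:ℝ)^2 : ℝ):ℂ)^(-w) = ((Real.pi/4 : ℝ):ℂ)^(-w) * (1 / (n:ℂ)^(2*w-1)) := by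
  have hn' : (n:ℂ) ≠ 0 := by exact_mod_cast hn
  rw [Complex.ofReal_mul, Complex.mul_cpow_ofReal_nonneg (by positivity) (by positivity), pow_two, Complex.ofReal_mul,
    Complex.mul_cpow_ofReal_nonneg (by positivity) (by positivity)]
  rw [one_div, ← Complex.cpow_neg]
  have : (n:ℂ)^(-(2*w-1)) = n * ((n:ℂ)^(-w) * (n:ℂ)^(-w)) := by
    rw [show -(2*w-1) = 1 + (-w + -w) by ring, Complex.cpow_add _ _ hn', Complex.cpow_add _ _ hn', Complex.cpow_one]
  rw [this]; push_cast; ring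

lemma auxch_eq (n : ℕ) : (ZMod.χ₄.ringHomComp (Int.castRingHom ℂ)) (n : ZMod 4) = auxch n := rfl

open MeasureTheory in
lemma aux_mellin_big (ω : ℂ) (hω : 0 < ω.re) (w : ℂ) (hw : 1 < w.re) :
    mellin (fun p : ℝ => auxθ (ω * p)) w
      = ω^(-w) * ((Real.pi/4 : ℝ):ℂ)^(-w) * Complex.Gamma w * Lchi4 (2*w-1) := by
  have hω0 : ω ≠ 0 := by intro h; simp [h] at hω
  have hw0 : 0 < w.re := by linarith
  set G : ℕ → ℝ → ℂ := fun n t => (t:ℂ)^(w-1) * auxθt n (ω * t) with hG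
  have hGe : ∀ (n : ℕ) (t : ℝ), G n t = (n * auxch n) * ((t:ℂ)^(w-1) * Complex.exp (-((((Real.pi/4 * (n:ℝ)^2 : ℝ):ℂ) * ω) * t))) := by
    intro n t
    simp only [hG, auxθt]
    push_cast
    rw [show -(Real.pi/4*(n:ℂ)^2*(ω*t)) = -(Real.pi/4*(n:ℂ)^2*ω*t) by ring]
    ring
  have hre : ∀ n : ℕ, n ≠ 0 → 0 < (((Real.pi/4 * (n:ℝ)^2 : ℝ):ℂ) * ω).re := by
    intro n hn
    rw [Complex.re_ofReal_mul]
    have := Real.pi_pos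
    positivity
  have hG0 : G 0 = 0 := by ext t; simp [hGe]
  have hInt : ∀ n, IntegrableOn (G n) (Set.Ioi 0) := by
    intro n
    by_cases hn : n = 0
    · subst hn; rw [hG0]; exact integrableOn_zero
    · have := (aux_cpow_int w hw0 _ (hre n hn)).const_mul (n * auxch n)
      exact this.congr (Filter.Eventually.of_forall fun t => (hGe n t).symm)
  have hval : ∀ n, ∫ t in Set.Ioi (0:ℝ), G n t = (ω^(-w) * ((Real.pi/4 : ℝ):ℂ)^(-w) * Complex.Gamma w) * LSeries.term (fun n => auxch n) (2*w-1) n := by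
    intro n
    by_cases hn : n = 0
    · subst hn; rw [hG0]; simp
    · simp_rw [hGe]
      rw [integral_const_mul, aux_gamma_cplx w hw0 _ (hre n hn), LSeries.term_of_ne_zero hn,
        aux_cpow_pos_mul _ (by have := Real.pi_pos; positivity) _ _ hω0]
      have := aux_nat_cpow n hn w
      linear_combination (auxch n * ω^(-w) * Complex.Gamma w) * this
  have hsumm : Summable (fun n => ∫ t in Set.Ioi (0:ℝ), ‖G n t‖) := by
    have hs : Summable (fun n : ℕ => (n:ℝ)^(-(2*w.re-1))) := by
      rw [Real.summable_nat_rpow]; linarith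
    refine Summable.of_nonneg_of_le (fun n => integral_nonneg fun _ => norm_nonneg _) (fun n => ?_)
      (hs.mul_left ((1/(Real.pi/4*ω.re))^w.re * Real.Gamma w.re))
    have hpi := Real.pi_pos
    by_cases hn : n = 0
    · subst hn; rw [hG0]; simp only [Pi.zero_apply, norm_zero, integral_zero]
      have := Real.Gamma_pos_of_pos hw0
      positivity
    · have hr := hre n hn
      rw [Complex.re_ofReal_mul] at hr
      have hI := Real.integral_rpow_mul_exp_neg_mul_Ioi hw0 hr
      have hn0 : (0:ℝ) < n := by positivity
      have e : ∫ t in Set.Ioi (0:ℝ), ‖G n t‖ = (n * ‖auxch n‖) * ∫ t in Set.Ioi (0:ℝ), t^(w.re-1) * Real.exp (-(Real.pi/4 * (n:ℝ)^2 * ω.re * t)) := by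
        rw [← integral_const_mul]
        refine setIntegral_congr_fun measurableSet_Ioi fun t ht => ?_
        have ht : 0 < t := ht
        rw [hGe, norm_mul, norm_mul, norm_mul, Complex.norm_natCast, Complex.norm_cpow_eq_rpow_re_of_pos ht, Complex.norm_exp]
        rw [Complex.neg_re, Complex.re_mul_ofReal, Complex.re_ofReal_mul]
        simp
      rw [e, hI]
      have hΓ := Real.Gamma_pos_of_pos hw0
      have e2 : (n:ℝ) * (1/(Real.pi/4 * (n:ℝ)^2 * ω.re))^w.re = (1/(Real.pi/4*ω.re))^w.re * (n:ℝ)^(-(2*w.re-1)) := by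
        rw [show 1/(Real.pi/4 * (n:ℝ)^2 * ω.re) = (1/(Real.pi/4*ω.re)) * ((n:ℝ)^(-2:ℝ)) by
          rw [Real.rpow_neg hn0.le]; norm_cast; field_simp]
        rw [Real.mul_rpow (by positivity) (by positivity), ← Real.rpow_mul hn0.le,
          show -(2*w.re-1) = 1 + -2*w.re by ring, Real.rpow_add hn0, Real.rpow_one]
        ring
      calc _ ≤ ((n:ℝ) * 1) * ((1/(Real.pi/4 * (n:ℝ)^2 * ω.re))^w.re * Real.Gamma w.re) := by
            gcongr; exact auxch_norm n
        _ = ((n:ℝ) * (1/(Real.pi/4 * (n:ℝ)^2 * ω.re))^w.re) * Real.Gamma w.re := by ring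
        _ = (1/(Real.pi/4*ω.re))^w.re * (n:ℝ)^(-(2*w.re-1)) * Real.Gamma w.re := by rw [e2]
        _ = _ := by ring
        _ ≤ _ := le_rfl
  have hHS := hasSum_integral_of_summable_integral_norm hInt hsumm
  have hm : mellin (fun p : ℝ => auxθ (ω * p)) w = ∫ t in Set.Ioi (0:ℝ), ∑' n, G n t := by
    unfold mellin
    refine setIntegral_congr_fun measurableSet_Ioi fun t ht => ?_
    simp only [smul_eq_mul, auxθ, hG]
    rw [tsum_mul_left]
  rw [hm, ← hHS.tsum_eq]
  simp_rw [hval]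
  rw [tsum_mul_left]
  congr 1
  unfold Lchi4
  rw [DirichletCharacter.LFunction_eq_LSeries _ (by simp; linarith)]
  rfl


lemma aux_norm_cpow32 (z : ℂ) : ‖z^(3/2:ℂ)‖ = ‖z‖^(3/2:ℝ) := by
  have := Complex.norm_cpow_real z (3/2)
  rw [← this]; norm_num

lemma auxθ_bounds : ∃ C, 0 < C ∧ ∀ ω : ℂ, ‖ω‖ = 1 → 0 < ω.re → ∀ p : ℝ, 0 < p →
    ‖auxθ (ω * p)‖ ≤ C * (ω.re^3)⁻¹ * p^(-3:ℝ) ∧ ‖auxθ (ω * p)‖ ≤ C * (ω.re^3)⁻¹ * p^(3/2:ℝ) := by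
  obtain ⟨C, hC, h⟩ := auxθ_norm_le
  refine ⟨C, hC, fun ω hω hr p hp => ?_⟩
  have hp3 : p^(-3:ℝ) = (p^3)⁻¹ := by rw [Real.rpow_neg hp.le]; norm_cast
  have h1 := h (ω * p) (by rw [Complex.re_mul_ofReal]; positivity)
  rw [Complex.re_mul_ofReal] at h1
  have hω0 : ω ≠ 0 := by intro h; simp [h] at hr
  have hpc : (p:ℂ) ≠ 0 := by exact_mod_cast hp.ne'
  constructor
  · rw [hp3]; refine h1.trans (le_of_eq ?_); field_simp
  · have hre : ((ω * p)⁻¹).re = ω.re * p⁻¹ := by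
      rw [mul_inv, ← Complex.ofReal_inv, Complex.re_mul_ofReal, Complex.inv_re, Complex.normSq_eq_norm_sq, hω]; simp
    have hz : 0 < ((ω * p)⁻¹).re := by rw [hre]; positivity
    have h2 := auxθ_mod ((ω * p)⁻¹) hz
    have h3 := h _ hz
    rw [one_div, inv_inv] at h2
    rw [h2, norm_mul, aux_norm_cpow32, norm_inv, norm_mul, hω, one_mul, Complex.norm_real, Real.norm_of_nonneg hp.le]
    rw [hre] at h3
    calc _ ≤ p⁻¹^(3/2:ℝ) * (C * ((ω.re * p⁻¹)^3)⁻¹) := by gcongr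
      _ = C * (ω.re^3)⁻¹ * (p^(-(3/2):ℝ) * p^(3:ℝ)) := by
        rw [Real.inv_rpow hp.le, ← Real.rpow_neg hp.le]
        norm_cast; field_simp
      _ = _ := by rw [← Real.rpow_add hp]; norm_num

lemma auxch_ne_one : (ZMod.χ₄.ringHomComp (Int.castRingHom ℂ) : DirichletCharacter ℂ 4) ≠ 1 := by
  intro h
  have := congrArg (fun f => f (3 : ZMod 4)) h
  have h3 : ZMod.χ₄ (3 : ZMod 4) = -1 := by decide
  simp [MulChar.ringHomComp_apply, h3] at this
  rw [MulChar.one_apply (by decide)] at this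
  norm_num at this

lemma auxL_diff : Differentiable ℂ Lchi4 := by
  unfold Lchi4
  exact DirichletCharacter.differentiable_LFunction auxch_ne_one

open MeasureTheory in
lemma aux_mellin (ω : ℂ) (hn : ‖ω‖ = 1) (hω : 0 < ω.re) (w : ℂ) (hw : 1/2 < w.re) (hw' : w.re < 3) :
    mellin (fun p : ℝ => auxθ (ω * p)) w
      = ω^(-w) * ((Real.pi/4 : ℝ):ℂ)^(-w) * Complex.Gamma w * Lchi4 (2*w-1) := by
  have hω0 : ω ≠ 0 := by intro h; simp [h] at hω
  obtain ⟨C, hC, hb⟩ := auxθ_bounds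
  have hcont : ContinuousOn (fun p : ℝ => auxθ (ω * p)) (Set.Ioi 0) := by
    intro p hp
    have hp : 0 < p := hp
    have : 0 < (ω * p).re := by rw [Complex.re_mul_ofReal]; positivity
    have h1 := (auxθ_differentiableAt _ this).continuousAt
    have h2 : ContinuousAt (fun p : ℝ => ω * (p:ℂ)) p := by fun_prop
    exact (ContinuousAt.comp (f := fun p : ℝ => ω * (p:ℂ)) h1 h2).continuousWithinAt
  set S : Set ℂ := {w | 1/2 < w.re ∧ w.re < 3} with hS
  have hSo : IsOpen S := (isOpen_lt continuous_const Complex.continuous_re).inter (isOpen_lt Complex.continuous_re continuous_const)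
  have hSc : Convex ℝ S := (convex_halfSpace_re_gt _).inter (convex_halfSpace_re_lt _)
  have hF : AnalyticOnNhd ℂ (mellin (fun p : ℝ => auxθ (ω * p))) S := by
    refine DifferentiableOn.analyticOnNhd (fun w hw => ?_) hSo
    refine (mellin_differentiableAt_of_isBigO_rpow (a := 3) (b := -(3/2)) (hcont.locallyIntegrableOn measurableSet_Ioi) ?_ hw.2 ?_ (by have := hw.1; linarith)).differentiableWithinAt
    · refine Asymptotics.IsBigO.of_bound (C * (ω.re^3)⁻¹) ?_
      filter_upwards [Filter.eventually_gt_atTop 0] with p hp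
      rw [Real.norm_of_nonneg (by positivity)]
      exact (hb ω hn hω p hp).1
    · refine Asymptotics.IsBigO.of_bound (C * (ω.re^3)⁻¹) ?_
      filter_upwards [self_mem_nhdsWithin] with p hp
      have hp : 0 < p := hp
      rw [Real.norm_of_nonneg (by positivity), neg_neg]
      exact (hb ω hn hω p hp).2
  have hpi : ((Real.pi/4 : ℝ):ℂ) ≠ 0 := by exact_mod_cast (by have := Real.pi_pos; positivity : Real.pi/4 ≠ 0)
  have hG : AnalyticOnNhd ℂ (fun w => ω^(-w) * ((Real.pi/4 : ℝ):ℂ)^(-w) * Complex.Gamma w * Lchi4 (2*w-1)) S := by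
    refine DifferentiableOn.analyticOnNhd (fun w hw => ?_) hSo
    refine DifferentiableAt.differentiableWithinAt ?_
    refine ((DifferentiableAt.mul ?_ ?_).mul ?_).mul ?_
    · exact differentiableAt_id.neg.const_cpow (Or.inl hω0)
    · exact differentiableAt_id.neg.const_cpow (Or.inl hpi)
    · refine Complex.differentiableAt_Gamma _ fun m hm => ?_
      have h1 := hw.1
      rw [hm] at h1
      simp at h1
      have : (0:ℝ) ≤ m := by positivity
      linarith
    · exact DifferentiableAt.comp w (auxL_diff _) (by fun_prop)
  refine hF.eqOn_of_preconnected_of_eventuallyEq hG hSc.isPreconnected (z₀ := 2) ?_ ?_ ⟨hw, hw'⟩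
  · constructor <;> norm_num
  · have : {w : ℂ | 1 < w.re} ∈ nhds (2:ℂ) := (isOpen_lt continuous_const Complex.continuous_re).mem_nhds (by simp)
    filter_upwards [this] with w hw
    exact aux_mellin_big ω hω w hw


noncomputable def auxg (ω : ℂ) (u : ℝ) : ℂ := auxθ (ω * (Real.exp u : ℝ))

noncomputable def auxΦ (ω : ℂ) (v : ℝ) : ℂ := ∫ u : ℝ, auxg ω u * auxg ω (v - u)

lemma auxg_cont (ω : ℂ) (hr : 0 < ω.re) : Continuous (auxg ω) := by
  rw [continuous_iff_continuousAt]
  intro u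
  have : 0 < (ω * (Real.exp u : ℝ)).re := by rw [Complex.re_mul_ofReal]; positivity
  have h1 := (auxθ_differentiableAt _ this).continuousAt
  have h2 : ContinuousAt (fun p : ℝ => ω * ((Real.exp p : ℝ):ℂ)) u := by fun_prop
  exact (ContinuousAt.comp (f := fun p : ℝ => ω * ((Real.exp p : ℝ):ℂ)) h1 h2)

lemma auxg_bound (ω : ℂ) (hn : ‖ω‖ = 1) (hr : 0 < ω.re) : ∃ M, 0 < M ∧ ∀ a : ℝ, 0 ≤ a → a ≤ 1 → ∀ u,
    ‖auxg ω u‖ * Real.exp (a * u) ≤ M * Real.exp (-|u|) := by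
  obtain ⟨C, hC, hb⟩ := auxθ_bounds
  refine ⟨C * (ω.re^3)⁻¹, by positivity, fun a ha ha1 u => ?_⟩
  obtain ⟨h1, h2⟩ := hb ω hn hr (Real.exp u) (Real.exp_pos u)
  rw [← Real.exp_mul] at h1 h2
  rcases le_total 0 u with hu | hu
  · calc _ ≤ (C * (ω.re^3)⁻¹ * Real.exp (u * -3)) * Real.exp (a * u) := by
          gcongr; exact h1
      _ = C * (ω.re^3)⁻¹ * Real.exp (u * -3 + a * u) := by rw [Real.exp_add]; ring
      _ ≤ _ := by
        gcongr
        rw [abs_of_nonneg hu]; nlinarith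
  · calc _ ≤ (C * (ω.re^3)⁻¹ * Real.exp (u * (3/2))) * Real.exp (a * u) := by
          gcongr; exact h2
      _ = C * (ω.re^3)⁻¹ * Real.exp (u * (3/2) + a * u) := by rw [Real.exp_add]; ring
      _ ≤ _ := by
        gcongr
        rw [abs_of_nonpos hu]; nlinarith

open MeasureTheory in
lemma aux_int_exp_abs : Integrable (fun u : ℝ => Real.exp (-|u|)) := by
  refine (integrable_inv_one_add_sq.const_mul 2).mono' (by fun_prop) (Filter.Eventually.of_forall fun u => ?_)
  rw [Real.norm_of_nonneg (by positivity), Real.exp_neg, ← div_eq_mul_inv, inv_eq_one_div, div_le_div_iff₀ (by positivity) (by positivity)]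
  have := Real.quadratic_le_exp_of_nonneg (abs_nonneg u)
  rw [sq_abs] at this
  have := abs_nonneg u
  linarith

open MeasureTheory in
lemma aux_mellin_g (ω w : ℂ) : mellin (fun p : ℝ => auxθ (ω * p)) w = ∫ u : ℝ, auxg ω u * Complex.exp (w * u) := by
  have himg : Real.exp '' Set.univ = Set.Ioi 0 := by rw [Set.image_univ, Real.range_exp]
  rw [mellin, ← himg, integral_image_eq_integral_abs_deriv_smul MeasurableSet.univ
    (fun x _ => (Real.hasDerivAt_exp x).hasDerivWithinAt) Real.exp_injective.injOn, setIntegral_univ]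
  congr 1; ext u
  rw [abs_of_pos (Real.exp_pos u), Complex.real_smul, smul_eq_mul, auxg]
  have : ((Real.exp u : ℝ):ℂ) * ((Real.exp u : ℝ):ℂ)^(w-1) = Complex.exp (w * u) := by
    rw [Complex.ofReal_exp, Complex.cpow_def_of_ne_zero (Complex.exp_ne_zero _), ← Complex.ofReal_exp, ← Complex.ofReal_log (Real.exp_pos u).le, Real.log_exp, Complex.ofReal_exp, ← Complex.exp_add]
    congr 1; ring
  rw [← mul_assoc, this, mul_comm]

open MeasureTheory in
lemma auxg_integrable (ω : ℂ) (hn : ‖ω‖ = 1) (hr : 0 < ω.re) (w : ℂ) (h0 : 0 ≤ w.re) (h1 : w.re ≤ 1) :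
    Integrable (fun u : ℝ => auxg ω u * Complex.exp (w * u)) := by
  obtain ⟨M, hM, hb⟩ := auxg_bound ω hn hr
  have := auxg_cont ω hr
  refine (aux_int_exp_abs.const_mul M).mono' (by fun_prop) (Filter.Eventually.of_forall fun u => ?_)
  rw [norm_mul, Complex.norm_exp, Complex.re_mul_ofReal]
  exact hb _ h0 h1 u

open MeasureTheory ContinuousLinearMap in
open scoped Convolution in
lemma auxΦ_conv (ω : ℂ) (w : ℂ) (v : ℝ) :
    ((fun u : ℝ => auxg ω u * Complex.exp (w * u)) ⋆[mul ℂ ℂ, volume] (fun u : ℝ => auxg ω u * Complex.exp (w * u))) v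
      = Complex.exp (w * v) * auxΦ ω v := by
  rw [convolution_def, auxΦ, ← integral_const_mul]
  congr 1; ext u
  rw [mul_apply', show w * (v:ℂ) = w * u + w * ((v - u : ℝ):ℂ) by push_cast; ring, Complex.exp_add]
  ring

open MeasureTheory ContinuousLinearMap in
lemma auxΦ_sq (ω : ℂ) (hn : ‖ω‖ = 1) (hr : 0 < ω.re) (w : ℂ) (h0 : 0 ≤ w.re) (h1 : w.re ≤ 1) :
    Integrable (fun v : ℝ => Complex.exp (w * v) * auxΦ ω v) ∧
    ∫ v : ℝ, Complex.exp (w * v) * auxΦ ω v = (mellin (fun p : ℝ => auxθ (ω * p)) w)^2 := by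
  have hi := auxg_integrable ω hn hr w h0 h1
  constructor
  · refine (hi.integrable_convolution (mul ℂ ℂ) hi).congr (Filter.Eventually.of_forall fun v => ?_)
    exact auxΦ_conv ω w v
  · have := integral_convolution (mul ℂ ℂ) hi hi
    rw [aux_mellin_g, pow_two]
    rw [mul_apply'] at this
    rw [← this]
    congr 1; ext v; rw [auxΦ_conv]

open MeasureTheory in
lemma auxΦ_bdd (ω : ℂ) (hn : ‖ω‖ = 1) (hr : 0 < ω.re) (κ : ℝ) (h0 : 0 ≤ κ) (h1 : κ ≤ 1) :
    ∃ M, ∀ v : ℝ, ‖Complex.exp (κ * v) * auxΦ ω v‖ ≤ M := by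
  obtain ⟨M, hM, hb⟩ := auxg_bound ω hn hr
  refine ⟨∫ u : ℝ, (M * Real.exp (-|u|)) * M, fun v => ?_⟩
  rw [auxΦ, ← integral_const_mul]
  refine norm_integral_le_of_norm_le ((aux_int_exp_abs.const_mul M).mul_const M) (Filter.Eventually.of_forall fun u => ?_)
  rw [norm_mul, norm_mul, Complex.norm_exp, ← Complex.ofReal_mul, Complex.ofReal_re,
    show κ * v = κ * u + κ * (v - u) by ring, Real.exp_add]
  have h2 := hb κ h0 h1 u
  have h3 := (hb κ h0 h1 (v - u)).trans (mul_le_of_le_one_right hM.le (Real.exp_le_one_iff.2 (by simp)))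
  calc _ = (‖auxg ω u‖ * Real.exp (κ * u)) * (‖auxg ω (v - u)‖ * Real.exp (κ * (v - u))) := by ring
    _ ≤ _ := by gcongr

lemma auxg_neg (ω : ℂ) (hn : ‖ω‖ = 1) (hr : 0 < ω.re) (u : ℝ) :
    auxg ω (-u) = ((starRingEnd ℂ) ω)^(3/2:ℂ) * (Real.exp (3/2*u) : ℝ) * (starRingEnd ℂ) (auxg ω u) := by
  have hω0 : ω ≠ 0 := by intro h; simp [h] at hr
  have hp := Real.exp_pos u
  set z : ℂ := (Real.exp u : ℝ) * (starRingEnd ℂ) ω with hz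
  have hzr : 0 < z.re := by rw [hz, Complex.re_ofReal_mul, Complex.conj_re]; positivity
  have h := auxθ_mod z hzr
  have h1 : 1 / z = ω * (Real.exp (-u) : ℝ) := by
    rw [hz, Real.exp_neg, one_div, mul_inv, Complex.inv_def ((starRingEnd ℂ) ω), Complex.normSq_conj, Complex.normSq_eq_norm_sq, hn]
    simp [mul_comm]
  have h2 : z = (starRingEnd ℂ) (ω * (Real.exp u : ℝ)) := by
    rw [hz, map_mul, Complex.conj_ofReal, mul_comm]
  rw [auxg, ← h1, h]
  rw [auxg, ← auxθ_conj, ← h2, hz, aux_cpow_pos_mul _ hp _ _ (by simpa using hω0)]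
  have : ((Real.exp u : ℝ):ℂ)^(3/2:ℂ) = (Real.exp (3/2*u) : ℝ) := by
    rw [show (3/2:ℂ) = ((3/2:ℝ):ℂ) by norm_num, ← Complex.ofReal_cpow hp.le, ← Real.exp_mul]
    congr 2; ring
  rw [this]; ring

open MeasureTheory in
lemma auxΦ_neg (ω : ℂ) (hn : ‖ω‖ = 1) (hr : 0 < ω.re) (v : ℝ) :
    ‖auxΦ ω (-v)‖ = Real.exp (3/2*v) * ‖auxΦ ω v‖ := by
  have e : auxΦ ω (-v) = (((starRingEnd ℂ) ω)^(3/2:ℂ))^2 * (Real.exp (3/2*v) : ℝ) * (starRingEnd ℂ) (auxΦ ω v) := by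
    rw [auxΦ, auxΦ, ← integral_conj, ← integral_const_mul, ← integral_neg_eq_self]
    congr 1; ext u
    rw [show -v - -u = -(v - u) by ring, auxg_neg ω hn hr, auxg_neg ω hn hr, map_mul,
      show 3/2*v = 3/2*u + 3/2*(v-u) by ring, Real.exp_add]
    push_cast; ring
  rw [e, norm_mul, norm_mul, norm_pow, aux_norm_cpow32, RCLike.norm_conj, RCLike.norm_conj, hn, Complex.norm_real,
    Real.norm_of_nonneg (Real.exp_pos _).le]
  simp

open MeasureTheory in
lemma aux_fourth (ω : ℂ) (hn : ‖ω‖ = 1) (hr : 0 < ω.re) (κ : ℝ) (h0 : 3/4 ≤ κ) (h1 : κ ≤ 1)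
    (a B : ℝ) (ha : 0 ≤ a) (haB : a ≤ B) (hB : 0 < B) :
    IntegrableOn (fun v : ℝ => Real.exp (2*κ*v) * ‖auxΦ ω v‖^2) (Set.Ioi 0) ∧
    ∫ τ in a..B, ‖mellin (fun p : ℝ => auxθ (ω * p)) (κ + τ * Complex.I)‖^4 ≤
      2 * Real.pi * Real.exp 1 * (2 * ∫ v in Set.Ioi (0:ℝ), Real.exp (2*κ*v) * ‖auxΦ ω v‖^2) := by
  have hi := (auxΦ_sq ω hn hr κ (by simp; linarith) (by simp; linarith)).1
  obtain ⟨M, hM⟩ := auxΦ_bdd ω hn hr κ (by linarith) h1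
  have hnm : ∀ v : ℝ, ‖Complex.exp (κ * v) * auxΦ ω v‖^2 = Real.exp (2*κ*v) * ‖auxΦ ω v‖^2 := by
    intro v
    rw [norm_mul, Complex.norm_exp, ← Complex.ofReal_mul, Complex.ofReal_re, mul_pow, ← Real.exp_nat_mul]
    congr 2; push_cast; ring
  have h2 : Integrable (fun v : ℝ => ‖Complex.exp (κ * v) * auxΦ ω v‖^2) := by
    refine (hi.norm.const_mul M).mono' (hi.1.norm.pow 2) (Filter.Eventually.of_forall fun v => ?_)
    rw [Real.norm_of_nonneg (by positivity), pow_two]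
    gcongr; exact hM v
  have hP := aux_plancherel _ hi h2 a B ha haB hB
  simp_rw [hnm] at hP h2
  refine ⟨h2.integrableOn, ?_⟩
  have hL : ∀ τ : ℝ, ‖∫ v : ℝ, Complex.exp (κ * v) * auxΦ ω v * Complex.exp (Complex.I * τ * v)‖^2 = ‖mellin (fun p : ℝ => auxθ (ω * p)) (κ + τ * Complex.I)‖^4 := by
    intro τ
    have := (auxΦ_sq ω hn hr (κ + τ * Complex.I) (by simp; linarith) (by simp; linarith)).2
    have e : ∀ v : ℝ, Complex.exp (κ * v) * auxΦ ω v * Complex.exp (Complex.I * τ * v) = Complex.exp ((κ + τ * Complex.I) * v) * auxΦ ω v := by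
      intro v
      rw [show (κ + τ * Complex.I) * (v:ℂ) = κ * v + Complex.I * τ * v by ring, Complex.exp_add]; ring
    simp_rw [e]
    rw [this, norm_pow, ← pow_mul]
  simp_rw [hL] at hP
  refine hP.trans ?_
  refine mul_le_mul_of_nonneg_left ?_ (by positivity)
  rw [← integral_add_compl (measurableSet_Ioi (a := (0:ℝ))) h2]
  refine le_trans (add_le_add_right ?_ _) (two_mul _).ge
  rw [Set.compl_Ioi]
  have e := integral_comp_neg_Ioi (0:ℝ) (fun v : ℝ => Real.exp (2*κ*v) * ‖auxΦ ω v‖^2)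
  rw [neg_zero] at e
  rw [← e]
  refine setIntegral_mono_on ?_ h2.integrableOn measurableSet_Ioi fun v hv => ?_
  · exact h2.comp_neg.integrableOn
  · have hv : 0 < v := hv
    rw [auxΦ_neg ω hn hr, mul_pow, ← mul_assoc, ← Real.exp_nat_mul, ← Real.exp_add]
    gcongr
    push_cast; nlinarith


lemma aux_pair_summable (a : ℝ) (ha : 0 < a) :
    Summable (fun p : ℕ × ℕ => ((p.1 * p.2 : ℕ) : ℝ) * Real.exp (-(a * (p.1 * p.2 : ℕ)))) := by
  have hs : Summable (fun n : ℕ => (n:ℝ) * Real.exp (-(a/2) * n)) := by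
    have := Real.summable_pow_mul_exp_neg_nat_mul 1 (half_pos ha)
    simpa using this
  have h0 : ∀ n : ℕ, 0 ≤ (n:ℝ) * Real.exp (-(a/2) * n) := fun n => by positivity
  have h2 := hs.mul_of_nonneg hs h0 h0
  refine Summable.of_nonneg_of_le (fun p => by positivity) (fun p => ?_) h2
  rcases Nat.eq_zero_or_pos p.1 with h | h
  · simp [h]
  rcases Nat.eq_zero_or_pos p.2 with h' | h'
  · simp [h']
  have e1 : (1:ℝ) ≤ p.1 := by exact_mod_cast h
  have e2 : (1:ℝ) ≤ p.2 := by exact_mod_cast h'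
  push_cast
  calc (p.1:ℝ) * p.2 * Real.exp (-(a * (p.1 * p.2))) ≤ (p.1:ℝ) * p.2 * Real.exp (-(a/2) * p.1 + -(a/2) * p.2) := by
        gcongr
        nlinarith [mul_nonneg ha.le (sub_nonneg.2 e1), mul_nonneg (mul_nonneg ha.le (sub_nonneg.2 e1)) (sub_nonneg.2 e2), mul_nonneg ha.le (sub_nonneg.2 e2)]
    _ = _ := by rw [Real.exp_add]; ring

open MeasureTheory in
lemma aux_swap (a : ℝ) (ha : 0 < a) (F : ℕ × ℕ → ℝ → ℂ) (hm : ∀ p, Continuous (F p) ∨ AEStronglyMeasurable (F p))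
    (hb : ∀ p, ∃ s : ℝ, ∀ u, ‖F p u‖ ≤ ((p.1 * p.2 : ℕ) : ℝ) * Real.exp (-(a * (p.1 * p.2 : ℕ))) * Real.exp (-(a/2) * (u - s)^2)) :
    HasSum (fun p => ∫ u, F p u) (∫ u, ∑' p, F p u) := by
  have hg : Integrable (fun u : ℝ => Real.exp (-(a/2) * u^2)) := integrable_exp_neg_mul_sq (half_pos ha)
  choose s hs using hb
  have hgs : ∀ p, Integrable (fun u : ℝ => ((p.1 * p.2 : ℕ) : ℝ) * Real.exp (-(a * (p.1 * p.2 : ℕ))) * Real.exp (-(a/2) * (u - s p)^2)) :=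
    fun p => (hg.comp_sub_right (s p)).const_mul _
  have hi : ∀ p, Integrable (F p) := fun p =>
    (hgs p).mono' ((hm p).elim (fun h => h.aestronglyMeasurable) id) (Filter.Eventually.of_forall (hs p))
  refine hasSum_integral_of_summable_integral_norm hi ?_
  refine Summable.of_nonneg_of_le (fun p => integral_nonneg fun _ => norm_nonneg _) (fun p => ?_)
    ((aux_pair_summable a ha).mul_right (∫ u : ℝ, Real.exp (-(a/2) * u^2)))
  refine (integral_mono (hi p).norm (hgs p) (hs p)).trans (le_of_eq ?_)
  rw [integral_const_mul]
  congr 1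
  exact integral_sub_right_eq_self (fun u : ℝ => Real.exp (-(a/2) * u^2)) (s p)

lemma aux_cosh_lb (u : ℝ) : 1 + u^2/2 ≤ Real.cosh u := by
  have : Real.cosh u = Real.cosh (2 * (u/2)) := by congr 1; ring
  rw [this, Real.cosh_two_mul, Real.cosh_sq]
  have h : (u/2)^2 ≤ Real.sinh (u/2)^2 := by
    rw [sq_le_sq, Real.abs_sinh]
    exact Real.self_le_sinh_iff.2 (abs_nonneg _)
  nlinarith

noncomputable def auxz (ω : ℂ) (y : ℝ) : ℂ := (Real.pi/2 : ℝ) * (ω + 2 * (y:ℂ)^2)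

noncomputable def auxb (N : ℕ) : ℂ := N * auxch N * (N.divisors.card : ℕ)

noncomputable def auxΨ (ω : ℂ) (v y : ℝ) : ℂ :=
  ∑' N : ℕ, auxb N * Complex.exp (-(N * auxz ω y * (Real.exp (v/2) : ℝ)))

lemma auxz_re (ω : ℂ) (y : ℝ) : (auxz ω y).re = Real.pi/2 * (ω.re + 2 * y^2) := by
  rw [auxz, Complex.re_ofReal_mul, Complex.add_re, show (2 * (y:ℂ)^2) = ((2*y^2 : ℝ):ℂ) by push_cast; rfl, Complex.ofReal_re]

lemma auxz_im (ω : ℂ) (y : ℝ) : (auxz ω y).im = Real.pi/2 * ω.im := by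
  rw [auxz, Complex.im_ofReal_mul, Complex.add_im, show (2 * (y:ℂ)^2) = ((2*y^2 : ℝ):ℂ) by push_cast; rfl, Complex.ofReal_im, add_zero]

lemma aux_term_shift (ω : ℂ) (v : ℝ) (p : ℕ × ℕ) (h1 : p.1 ≠ 0) (h2 : p.2 ≠ 0) (u : ℝ) :
    auxθt p.1 (ω * (Real.exp (u + (v/2 + Real.log (p.2/p.1))) : ℝ)) * auxθt p.2 (ω * (Real.exp (v - (u + (v/2 + Real.log (p.2/p.1)))) : ℝ))
      = ((p.1*p.2 : ℕ) : ℂ) * auxch (p.1*p.2) * Complex.exp (-(((Real.pi/2 * (p.1*p.2 : ℕ) * Real.exp (v/2) : ℝ) : ℂ) * ω) * Real.cosh u) := by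
  have h1' : (0:ℝ) < p.1 := by positivity
  have h2' : (0:ℝ) < p.2 := by positivity
  have e1 : Real.exp (u + (v/2 + Real.log (p.2/p.1))) = Real.exp u * Real.exp (v/2) * (p.2/p.1) := by
    rw [Real.exp_add, Real.exp_add, Real.exp_log (by positivity)]; ring
  have e2 : Real.exp (v - (u + (v/2 + Real.log (p.2/p.1)))) = Real.exp (-u) * Real.exp (v/2) * (p.1/p.2) := by
    rw [show v - (u + (v/2 + Real.log ((p.2:ℝ)/p.1))) = -u + (v/2 + -Real.log (p.2/p.1)) by ring, Real.exp_add, Real.exp_add, ← Real.log_inv, Real.exp_log (by positivity), inv_div]; ring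
  rw [e1, e2, auxch_mul, auxθt, auxθt, Real.cosh_eq]
  have h1c : (p.1:ℂ) ≠ 0 := by exact_mod_cast h1
  have h2c : (p.2:ℂ) ≠ 0 := by exact_mod_cast h2
  rw [show ∀ a b c d e f : ℂ, a * b * c * (d * e * f) = a * d * (b * e) * (c * f) by intros; ring, ← Complex.exp_add]
  push_cast
  congr 2
  field_simp
  ring

open MeasureTheory in
lemma aux_rep1 (ω : ℂ) (hn : ‖ω‖ = 1) (hr : 0 < ω.re) (v : ℝ) :
    HasSum (fun p : ℕ × ℕ => ((p.1*p.2 : ℕ) : ℂ) * auxch (p.1*p.2) * ∫ u : ℝ, Complex.exp (-(((Real.pi/2 * (p.1*p.2 : ℕ) * Real.exp (v/2) : ℝ) : ℂ) * ω) * Real.cosh u)) (auxΦ ω v) := by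
  set a : ℝ := Real.pi/2 * Real.exp (v/2) * ω.re with haa
  have hpi := Real.pi_pos
  have ha : 0 < a := by positivity
  set T : ℕ × ℕ → ℝ → ℂ := fun p u => auxθt p.1 (ω * (Real.exp u : ℝ)) * auxθt p.2 (ω * (Real.exp (v - u) : ℝ)) with hT
  have hT0 : ∀ p u, p.1 * p.2 = 0 → T p u = 0 := by
    intro p u h
    rcases Nat.mul_eq_zero.1 h with h | h <;> simp [hT, auxθt, h]
  have hTc : ∀ p, Continuous (T p) := by
    intro p; simp only [hT, auxθt]; fun_prop
  have hTb : ∀ p, ∃ s : ℝ, ∀ u, ‖T p u‖ ≤ ((p.1 * p.2 : ℕ) : ℝ) * Real.exp (-(a * (p.1 * p.2 : ℕ))) * Real.exp (-(a/2) * (u - s)^2) := by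
    intro p
    refine ⟨v/2 + Real.log (p.2/p.1), fun u => ?_⟩
    by_cases h : p.1 * p.2 = 0
    · rw [hT0 p u h]; simp [h]
    · have h1 : p.1 ≠ 0 := fun h' => h (by simp [h'])
      have h2 : p.2 ≠ 0 := fun h' => h (by simp [h'])
      have := aux_term_shift ω v p h1 h2 (u - (v/2 + Real.log (p.2/p.1)))
      rw [sub_add_cancel] at this
      simp only [hT]
      rw [this]
      set u' := u - (v/2 + Real.log (p.2/p.1))
      rw [norm_mul, norm_mul, Complex.norm_natCast, Complex.norm_exp]
      have hN : (1:ℝ) ≤ (p.1*p.2 : ℕ) := by exact_mod_cast Nat.one_le_iff_ne_zero.2 h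
      have hre : (-(((Real.pi/2 * (p.1*p.2 : ℕ) * Real.exp (v/2) : ℝ) : ℂ) * ω) * Real.cosh u').re = -(a * (p.1*p.2 : ℕ) * Real.cosh u') := by
        rw [Complex.re_mul_ofReal, Complex.neg_re, Complex.re_ofReal_mul, haa]; ring
      rw [hre]
      have hc := aux_cosh_lb u'
      calc _ ≤ ((p.1*p.2 : ℕ):ℝ) * 1 * Real.exp (-(a * (p.1*p.2 : ℕ)) + -(a/2) * u'^2) := by
            gcongr
            · exact auxch_norm _
            · have h3 : a * (p.1*p.2 : ℕ) * (1 + u'^2/2) ≤ a * (p.1*p.2 : ℕ) * Real.cosh u' := by gcongr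
              nlinarith [mul_nonneg (mul_nonneg ha.le (sub_nonneg.2 hN)) (sq_nonneg u')]
        _ = _ := by rw [Real.exp_add]; ring
  have hS := aux_swap a ha T (fun p => Or.inl (hTc p)) hTb
  have hΦ : ∫ u, ∑' p, T p u = auxΦ ω v := by
    rw [auxΦ]
    congr 1; ext u
    rw [auxg, auxg, auxθ, auxθ, tsum_mul_tsum_of_summable_norm]
    · exact auxθ_summable _ (by rw [Complex.re_mul_ofReal]; positivity)
    · exact auxθ_summable _ (by rw [Complex.re_mul_ofReal]; positivity)
  rw [hΦ] at hS
  convert hS using 1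
  ext p
  by_cases h : p.1 * p.2 = 0
  · simp_rw [hT0 p _ h]; simp [h]
  · have h1 : p.1 ≠ 0 := fun h' => h (by simp [h'])
    have h2 : p.2 ≠ 0 := fun h' => h (by simp [h'])
    rw [← integral_const_mul, ← integral_add_right_eq_self (T p) (v/2 + Real.log (p.2/p.1))]
    congr 1; ext u
    exact (aux_term_shift ω v p h1 h2 u).symm

lemma aux_fiber (f : ℕ → ℂ) (h0 : f 0 = 0) (hs : Summable (fun p : ℕ × ℕ => f (p.1*p.2))) :
    ∑' p : ℕ × ℕ, f (p.1 * p.2) = ∑' N : ℕ, f N * (N.divisors.card : ℕ) := by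
  have h := hs.hasSum.tsum_fiberwise (fun p : ℕ × ℕ => p.1 * p.2)
  rw [← h.tsum_eq]
  congr 1; ext N
  have e : ∑' b : ((fun p : ℕ × ℕ => p.1 * p.2) ⁻¹' {N}), f (b.1.1 * b.1.2) = ∑' b : ((fun p : ℕ × ℕ => p.1 * p.2) ⁻¹' {N}), f N := by
    congr 1; ext b
    have := b.2
    simp only [Set.mem_preimage, Set.mem_singleton_iff] at this
    rw [this]
  rw [e]
  by_cases hN : N = 0
  · subst hN; simp [h0]
  · have : ((fun p : ℕ × ℕ => p.1 * p.2) ⁻¹' {N}) = ↑(N.divisorsAntidiagonal) := by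
      ext p; simp [hN]
    rw [this]
    rw [Finset.tsum_subtype' N.divisorsAntidiagonal (fun _ => f N), Finset.sum_const, nsmul_eq_mul, mul_comm]
    congr 2
    rw [← Nat.map_div_right_divisors, Finset.card_map]

open MeasureTheory in
lemma aux_rep (ω : ℂ) (hn : ‖ω‖ = 1) (hr : 0 < ω.re) (v : ℝ) :
    auxΦ ω v = 2 * ∫ y : ℝ, auxΨ ω v y * auxG ω y := by
  set a : ℝ := Real.pi/2 * Real.exp (v/2) * ω.re with haa
  have hpi := Real.pi_pos
  have ha : 0 < a := by positivity
  have hr1 : ω.re ≤ 1 := hn ▸ Complex.re_le_norm ω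
  set c : ℕ → ℝ → ℂ := fun N y => (N:ℂ) * auxch N * Complex.exp (-(N * auxz ω y * (Real.exp (v/2) : ℝ))) with hc
  have hcn : ∀ N y, ‖c N y‖ ≤ (N:ℝ) * Real.exp (-(a * N)) * Real.exp (-(a/2) * (y - 0)^2) := by
    intro N y
    simp only [hc]
    rw [norm_mul, norm_mul, Complex.norm_natCast, Complex.norm_exp]
    rcases Nat.eq_zero_or_pos N with rfl | hN
    · simp
    have hN : (1:ℝ) ≤ N := by exact_mod_cast hN
    have hre : (-(N * auxz ω y * (Real.exp (v/2) : ℝ))).re = -(N * (Real.pi/2 * (ω.re + 2 * y^2)) * Real.exp (v/2)) := by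
      rw [Complex.neg_re, Complex.re_mul_ofReal, show (N:ℂ) = ((N:ℝ):ℂ) by simp, Complex.re_ofReal_mul, auxz_re]
    rw [hre]
    calc _ ≤ (N:ℝ) * 1 * Real.exp (-(a * N) + -(a/2) * (y-0)^2) := by
          gcongr
          · exact auxch_norm _
          · rw [haa]
            have h3 : 0 ≤ Real.pi/2 * Real.exp (v/2) := by positivity
            have h4 : ω.re / 2 * y^2 ≤ N * (2 * y^2) := by nlinarith [sq_nonneg y, mul_nonneg (sub_nonneg.2 hN) (sq_nonneg y)]
            have := mul_le_mul_of_nonneg_left h4 h3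
            nlinarith
      _ = _ := by rw [Real.exp_add]; ring
  have hcc : ∀ N, Continuous (c N) := by
    intro N; simp only [hc, auxz]; fun_prop
  have hS := aux_swap a ha (fun p y => c (p.1*p.2) y * auxG ω y)
    (fun p => Or.inr ((hcc _).aestronglyMeasurable.mul (auxG_meas ω).aestronglyMeasurable))
    (fun p => ⟨0, fun y => by
      rw [norm_mul]
      exact (mul_le_of_le_one_right (norm_nonneg _) (auxG_norm ω hn hr y)).trans (hcn _ y)⟩)
  have h1 := (hS.mul_left 2)
  have h2 := aux_rep1 ω hn hr v
  have hΨ : ∀ y, ∑' p : ℕ × ℕ, c (p.1*p.2) y * auxG ω y = auxΨ ω v y * auxG ω y := by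
    intro y
    rw [tsum_mul_right]
    congr 1
    rw [aux_fiber (fun N => c N y) (by simp [hc]), auxΨ]
    · congr 1; ext N; simp only [hc, auxb]; ring
    · refine Summable.of_norm_bounded ((aux_pair_summable a ha).mul_right (Real.exp (-(a/2) * (y - 0)^2))) fun p => hcn _ y
  simp_rw [hΨ] at h1
  refine h2.unique ?_
  refine Eq.mp (congrArg (fun f => HasSum f _) (funext fun p => ?_)) h1
  symm
  by_cases h : p.1 * p.2 = 0
  · simp [h, hc]
  · have hN : (1:ℝ) ≤ (p.1*p.2 : ℕ) := by exact_mod_cast Nat.one_le_iff_ne_zero.2 h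
    rw [aux_kernel _ (by positivity) ω hr, ← integral_const_mul, ← integral_const_mul, ← integral_const_mul]
    congr 1; ext y
    simp only [hc]
    have : Complex.exp (-(((p.1*p.2 : ℕ):ℂ) * auxz ω y * (Real.exp (v/2) : ℝ))) = Complex.exp (-(((Real.pi/2 * (p.1*p.2 : ℕ) * Real.exp (v/2) : ℝ) : ℂ) * ω)) * Complex.exp (-(2 * ((Real.pi/2 * (p.1*p.2 : ℕ) * Real.exp (v/2) : ℝ) : ℂ) * (y:ℂ)^2)) := by
      rw [← Complex.exp_add]; congr 1; rw [auxz]; push_cast; ring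
    rw [this]; ring


lemma auxb_bound (η : ℝ) (hη : 0 < η) : ∃ B, 0 < B ∧ ∀ N : ℕ, ‖auxb N‖ ≤ B * (N:ℝ)^(1+η) := by
  obtain ⟨C, hC, h⟩ := aux_divisor_bound η hη
  refine ⟨C, hC, fun N => ?_⟩
  rcases Nat.eq_zero_or_pos N with rfl | hN
  · simp [auxb]; positivity
  have hN' : (0:ℝ) < N := by exact_mod_cast hN
  rw [auxb, norm_mul, norm_mul, Complex.norm_natCast, Complex.norm_natCast, Real.rpow_add hN', Real.rpow_one]
  calc _ ≤ (N:ℝ) * 1 * (C * (N:ℝ)^η) := by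
        gcongr
        · exact auxch_norm N
        · exact h N hN.ne'
    _ = _ := by ring

open MeasureTheory in
lemma auxΨ_meas (ω : ℂ) (hr : 0 < ω.re) : Measurable (fun q : ℝ × ℝ => auxΨ ω q.1 q.2) := by
  obtain ⟨B, hB, hb⟩ := auxb_bound 1 one_pos
  refine measurable_of_tendsto_metrizable (f := fun (n : ℕ) (q : ℝ × ℝ) => ∑ N ∈ Finset.range n, auxb N * Complex.exp (-(N * auxz ω q.2 * (Real.exp (q.1/2) : ℝ)))) ?_ ?_
  · intro n
    refine Continuous.measurable ?_
    unfold auxz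
    fun_prop
  · rw [tendsto_pi_nhds]
    intro q
    refine (Summable.hasSum ?_).tendsto_sum_nat
    have hz : 0 < (auxz ω q.2).re := by rw [auxz_re]; have := Real.pi_pos; positivity
    have := aux_b_summable 1 B one_pos auxb hb ((auxz ω q.2).re * Real.exp (q.1/2)) (by positivity)
    refine Summable.of_norm ?_
    refine this.congr fun N => ?_
    rw [norm_mul, Complex.norm_exp, Complex.neg_re, Complex.re_mul_ofReal, show (N:ℂ) = ((N:ℝ):ℂ) by simp, Complex.re_ofReal_mul, mul_assoc]

open MeasureTheory in
lemma aux_int_cauchy (δ : ℝ) (hδ : 0 < δ) :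
    ∫⁻ y : ℝ, ENNReal.ofReal ((δ + y^2)⁻¹) = ENNReal.ofReal (Real.pi / √δ) := by
  have e : ∀ y : ℝ, (δ + y^2)⁻¹ = δ⁻¹ * (1 + (y/√δ)^2)⁻¹ := by
    intro y
    rw [div_pow, Real.sq_sqrt hδ.le, ← mul_inv]; congr 1; field_simp
  have hs : 0 < √δ := by positivity
  have hi : Integrable (fun y : ℝ => (δ + y^2)⁻¹) := by
    simp_rw [e]
    exact (integrable_inv_one_add_sq.comp_div hs.ne').const_mul _
  rw [← ofReal_integral_eq_lintegral_ofReal hi (Filter.Eventually.of_forall fun y => by positivity)]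
  congr 1
  simp_rw [e]
  rw [integral_const_mul, Measure.integral_comp_div (fun y : ℝ => (1 + y^2)⁻¹), integral_univ_inv_one_add_sq, abs_of_pos hs, smul_eq_mul]
  have : δ = √δ * √δ := (Real.mul_self_sqrt hδ.le).symm
  field_simp
  rw [Real.sq_sqrt hδ.le]

open MeasureTheory in
lemma aux_cs (ω : ℂ) (hn : ‖ω‖ = 1) (hr : 0 < ω.re) (v : ℝ) :
    ENNReal.ofReal (‖auxΦ ω v‖^2) ≤ ENNReal.ofReal (4 * Real.pi / √ω.re) *
      ∫⁻ y : ℝ, ENNReal.ofReal ((ω.re + y^2) * ‖auxΨ ω v y‖^2) := by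
  have hm : Measurable (fun y : ℝ => auxΨ ω v y) :=
    Measurable.comp (g := fun q : ℝ × ℝ => auxΨ ω q.1 q.2) (f := fun y : ℝ => (v, y)) (auxΨ_meas ω hr) (by fun_prop)
  have hδ : ∀ y : ℝ, 0 < ω.re + y^2 := fun y => by positivity
  have h1 : ENNReal.ofReal ‖auxΦ ω v‖ ≤ ENNReal.ofReal 2 * ∫⁻ y : ℝ, ENNReal.ofReal ‖auxΨ ω v y‖ := by
    rw [aux_rep ω hn hr, norm_mul, ENNReal.ofReal_mul (norm_nonneg _), show ‖(2:ℂ)‖ = 2 by simp]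
    refine mul_le_mul_right ?_ _
    · rw [ofReal_norm]
      refine (enorm_integral_le_lintegral_enorm _).trans (lintegral_mono fun y => ?_)
      rw [← ofReal_norm, norm_mul]
      exact ENNReal.ofReal_le_ofReal (mul_le_of_le_one_right (norm_nonneg _) (auxG_norm ω hn hr y))
  have h2 := ENNReal.lintegral_mul_le_Lp_mul_Lq volume Real.HolderConjugate.two_two
    (f := fun y : ℝ => ENNReal.ofReal (√(ω.re + y^2))⁻¹) (g := fun y : ℝ => ENNReal.ofReal (√(ω.re + y^2) * ‖auxΨ ω v y‖))
    (by fun_prop) (by fun_prop)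
  have e1 : ∀ y : ℝ, ENNReal.ofReal ‖auxΨ ω v y‖ = ((fun y : ℝ => ENNReal.ofReal (√(ω.re + y^2))⁻¹) * (fun y : ℝ => ENNReal.ofReal (√(ω.re + y^2) * ‖auxΨ ω v y‖))) y := by
    intro y
    rw [Pi.mul_apply, ← ENNReal.ofReal_mul (by positivity)]
    congr 1
    have := Real.sqrt_pos.2 (hδ y)
    field_simp
  simp_rw [← e1] at h2
  have e2 : ∀ y : ℝ, ENNReal.ofReal (√(ω.re + y^2))⁻¹ ^ (2:ℝ) = ENNReal.ofReal ((ω.re + y^2)⁻¹) := by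
    intro y
    rw [ENNReal.ofReal_rpow_of_nonneg (by positivity) (by norm_num)]
    congr 1; norm_cast; rw [inv_pow, Real.sq_sqrt (hδ y).le]
  have e3 : ∀ y : ℝ, ENNReal.ofReal (√(ω.re + y^2) * ‖auxΨ ω v y‖) ^ (2:ℝ) = ENNReal.ofReal ((ω.re + y^2) * ‖auxΨ ω v y‖^2) := by
    intro y
    rw [ENNReal.ofReal_rpow_of_nonneg (by positivity) (by norm_num)]
    congr 1; norm_cast; rw [mul_pow, Real.sq_sqrt (hδ y).le]
  simp_rw [e2, e3] at h2
  rw [aux_int_cauchy _ hr] at h2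
  have hsq : ∀ a : ENNReal, (a ^ (1/2:ℝ))^2 = a := by
    intro a; rw [← ENNReal.rpow_natCast, ← ENNReal.rpow_mul]; norm_num
  calc _ = (ENNReal.ofReal ‖auxΦ ω v‖)^2 := by rw [ENNReal.ofReal_pow (norm_nonneg _)]
    _ ≤ (ENNReal.ofReal 2 * ((ENNReal.ofReal (Real.pi / √ω.re))^(1/2:ℝ) * (∫⁻ y : ℝ, ENNReal.ofReal ((ω.re + y^2) * ‖auxΨ ω v y‖^2))^(1/2:ℝ)))^2 := by
        gcongr
        refine h1.trans ?_
        gcongr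
    _ = _ := by
        rw [mul_pow, mul_pow, hsq, hsq, ← mul_assoc, ← ENNReal.ofReal_pow (by norm_num), ← ENNReal.ofReal_mul (by norm_num)]
        congr 2; ring


lemma aux_xs (x δ s : ℝ) (hx : 0 < x) (hδ : 0 < δ) (h0 : 0 ≤ s) (h1 : s ≤ 1) :
    x^(2+s) ≤ δ^(-s) * (x^2 + δ * x^3) := by
  have h : (δ*x)^s ≤ 1 + δ * x := by
    rcases le_total (δ*x) 1 with h | h
    · have := Real.rpow_le_one (by positivity) h h0
      have : 0 ≤ δ * x := by positivity
      linarith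
    · have := Real.rpow_le_rpow_of_exponent_le h h1
      rw [Real.rpow_one] at this
      linarith
  rw [Real.mul_rpow hδ.le hx.le] at h
  have e : δ^(-s) * δ^s = 1 := by rw [← Real.rpow_add hδ]; simp
  calc x^(2+s) = x^2 * x^s := by rw [Real.rpow_add hx]; norm_cast
    _ = δ^(-s) * x^2 * (δ^s * x^s) := by linear_combination (-(x^2 * x^s)) * e
    _ ≤ δ^(-s) * x^2 * (1 + δ * x) := by gcongr
    _ = _ := by ring

open MeasureTheory in
lemma aux_y (η : ℝ) (hη : 0 < η) : ∃ C, 0 < C ∧ ∀ ω : ℂ, ‖ω‖ = 1 → 0 < ω.re → 1/2 ≤ ω.im →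
    ∀ κ : ℝ, 3/4 ≤ κ → κ ≤ 1 → ∀ y : ℝ,
    ∫⁻ v in Set.Ioi (0:ℝ), ENNReal.ofReal (Real.exp (2*κ*v) * ‖auxΨ ω v y‖^2) ≤
      ENNReal.ofReal (C * ω.re^(-(4*κ-3)) * (ω.re + y^2)^(-(3+5*η))) := by
  obtain ⟨B, hB, hb⟩ := auxb_bound η hη
  obtain ⟨C2, hC2, h2⟩ := aux_meansq η B hη hB 2 le_rfl
  obtain ⟨C3, hC3, h3⟩ := aux_meansq η B hη hB 3 (by norm_num)
  refine ⟨2 * (C2 + C3), by positivity, fun ω hn hr him κ hκ0 hκ1 y => ?_⟩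
  have hpi := Real.pi_gt_three
  set z := auxz ω y with hz
  set δ := ω.re with hδ
  have hzr : z.re = Real.pi/2 * (δ + 2*y^2) := auxz_re ω y
  have hα : δ + y^2 ≤ z.re := by
    rw [hzr]
    nlinarith [sq_nonneg y]
  have hz0 : 0 < z.re := lt_of_lt_of_le (by positivity) hα
  have hδα : δ ≤ z.re := le_trans (by nlinarith [sq_nonneg y]) hα
  have hzi : 1/2 ≤ |z.im| := by
    rw [hz, auxz_im]
    refine le_trans ?_ (le_abs_self _)
    nlinarith
  obtain ⟨i2, b2⟩ := h2 auxb hb z hz0 hzi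
  obtain ⟨i3, b3⟩ := h3 auxb hb z hz0 hzi
  set S : ℝ → ℝ := fun x => ‖∑' N : ℕ, auxb N * Complex.exp (-(N*z*x))‖^2 with hS
  set s := 4*κ-3 with hs
  have hs0 : 0 ≤ s := by rw [hs]; linarith
  have hs1 : s ≤ 1 := by rw [hs]; linarith
  set g : ℝ → ℝ := fun x => 2 * δ^(-s) * (x^2 * S x + δ * (x^3 * S x)) with hg
  have hgi : IntegrableOn g (Set.Ioi 1) := (i2.add (i3.const_mul δ)).const_mul _
  have himg : (fun v : ℝ => Real.exp (v/2)) '' Set.Ioi 0 = Set.Ioi 1 := by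
    ext x
    simp only [Set.mem_image, Set.mem_Ioi]
    constructor
    · rintro ⟨v, hv, rfl⟩; exact Real.one_lt_exp_iff.2 (by linarith)
    · intro hx
      refine ⟨2 * Real.log x, by have := Real.log_pos hx; linarith, ?_⟩
      rw [mul_div_cancel_left₀ _ (two_ne_zero' ℝ), Real.exp_log (by linarith)]
  have hcv := lintegral_image_eq_lintegral_abs_deriv_mul (s := Set.Ioi (0:ℝ)) (f := fun v : ℝ => Real.exp (v/2)) (f' := fun v => Real.exp (v/2) * (1/2))
    measurableSet_Ioi (fun v _ => (((hasDerivAt_id v).div_const 2).exp).hasDerivWithinAt)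
    (fun a _ b _ hab => by have := Real.exp_injective hab; linarith) (fun x => ENNReal.ofReal (g x))
  rw [himg] at hcv
  have hg0 : ∀ x, 0 < x → 0 ≤ g x := fun x hx => by simp only [hg, hS]; positivity
  calc _ ≤ ∫⁻ v in Set.Ioi (0:ℝ), ENNReal.ofReal |Real.exp (v/2) * (1/2)| * ENNReal.ofReal (g (Real.exp (v/2))) := by
        refine setLIntegral_mono' measurableSet_Ioi fun v hv => ?_
        rw [← ENNReal.ofReal_mul (abs_nonneg _), abs_of_pos (by positivity)]
        refine ENNReal.ofReal_le_ofReal ?_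
        set x := Real.exp (v/2) with hx
        have hx0 : 0 < x := Real.exp_pos _
        have e1 : Real.exp (2*κ*v) = x * x^(2+s) := by
          rw [hx, ← Real.exp_mul, ← Real.exp_add]; congr 1; rw [hs]; ring
        have e2 : ‖auxΨ ω v y‖^2 = S x := rfl
        have hS0 : 0 ≤ S x := by simp only [hS]; positivity
        rw [e1, e2]
        calc x * x^(2+s) * S x ≤ x * (δ^(-s) * (x^2 + δ * x^3)) * S x := by
              gcongr; exact aux_xs x δ s hx0 hr hs0 hs1
          _ = _ := by simp only [hg]; ring
    _ = ENNReal.ofReal (∫ x in Set.Ioi 1, g x) := by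
        rw [← hcv, ofReal_integral_eq_lintegral_ofReal hgi]
        filter_upwards [ae_restrict_mem measurableSet_Ioi] with x hx
        exact hg0 x (lt_trans one_pos hx)
    _ ≤ _ := by
        refine ENNReal.ofReal_le_ofReal ?_
        have e : ∫ x in Set.Ioi 1, g x = 2 * δ^(-s) * ((∫ x in Set.Ioi 1, x^2 * S x) + δ * ∫ x in Set.Ioi 1, x^3 * S x) := by
          simp only [hg]
          rw [integral_const_mul, integral_add i2 (i3.const_mul δ), integral_const_mul]
        rw [e]
        have b3' : δ * ∫ x in Set.Ioi 1, x^3 * S x ≤ C3 * z.re^(-(3+5*η)) := by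
          calc _ ≤ δ * (C3 * z.re^(-(((3:ℕ):ℝ)+1+5*η))) := by gcongr
            _ ≤ z.re * (C3 * z.re^(-(((3:ℕ):ℝ)+1+5*η))) := by gcongr
            _ = C3 * (z.re^(1:ℝ) * z.re^(-(((3:ℕ):ℝ)+1+5*η))) := by rw [Real.rpow_one]; ring
            _ = _ := by rw [← Real.rpow_add hz0]; congr 2; push_cast; ring
        have b2' : ∫ x in Set.Ioi 1, x^2 * S x ≤ C2 * z.re^(-(3+5*η)) := by
          refine b2.trans (le_of_eq ?_); congr 2; push_cast; ring
        have hmono : z.re^(-(3+5*η)) ≤ (δ + y^2)^(-(3+5*η)) :=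
          Real.rpow_le_rpow_of_nonpos (by positivity) hα (by linarith)
        calc _ ≤ 2 * δ^(-s) * (C2 * z.re^(-(3+5*η)) + C3 * z.re^(-(3+5*η))) := by gcongr
          _ = 2 * (C2 + C3) * δ^(-s) * z.re^(-(3+5*η)) := by ring
          _ ≤ _ := by gcongr

open MeasureTheory in
lemma aux_Φ_int (η : ℝ) (hη : 0 < η) : ∃ C, 0 < C ∧ ∀ ω : ℂ, ‖ω‖ = 1 → 0 < ω.re → 1/2 ≤ ω.im →
    ∀ κ : ℝ, 3/4 ≤ κ → κ ≤ 1 →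
    ∫ v in Set.Ioi (0:ℝ), Real.exp (2*κ*v) * ‖auxΦ ω v‖^2 ≤ C * ω.re^(-(4*κ-1) - 5*η) := by
  obtain ⟨C, hC, hy⟩ := aux_y η hη
  have hpi := Real.pi_pos
  refine ⟨4 * Real.pi * Real.pi * C, by positivity, fun ω hn hr him κ hκ0 hκ1 => ?_⟩
  have hint := (aux_fourth ω hn hr κ hκ0 hκ1 0 1 le_rfl zero_le_one one_pos).1
  set δ := ω.re with hδ
  have hm := auxΨ_meas ω hr
  rw [← ENNReal.ofReal_le_ofReal_iff (by positivity), ofReal_integral_eq_lintegral_ofReal hint (Filter.Eventually.of_forall fun v => by positivity)]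
  have hD : ∀ y : ℝ, 0 < δ + y^2 := fun y => by positivity
  calc _ ≤ ∫⁻ v in Set.Ioi (0:ℝ), ENNReal.ofReal (4 * Real.pi / √δ) * ∫⁻ y : ℝ, ENNReal.ofReal (δ + y^2) * ENNReal.ofReal (Real.exp (2*κ*v) * ‖auxΨ ω v y‖^2) := by
        refine lintegral_mono fun v => ?_
        rw [ENNReal.ofReal_mul (by positivity)]
        refine (mul_le_mul_right (aux_cs ω hn hr v) _).trans (le_of_eq ?_)
        rw [mul_left_comm, ← lintegral_const_mul' _ _ ENNReal.ofReal_ne_top]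
        congr 2; ext y
        rw [← ENNReal.ofReal_mul (by positivity), ← ENNReal.ofReal_mul (hD y).le]
        congr 1; ring
    _ = ENNReal.ofReal (4 * Real.pi / √δ) * ∫⁻ y : ℝ, ENNReal.ofReal (δ + y^2) * ∫⁻ v in Set.Ioi (0:ℝ), ENNReal.ofReal (Real.exp (2*κ*v) * ‖auxΨ ω v y‖^2) := by
        rw [lintegral_const_mul' _ _ ENNReal.ofReal_ne_top, lintegral_lintegral_swap]
        · congr 2; ext y
          rw [lintegral_const_mul' _ _ ENNReal.ofReal_ne_top]
        · refine Measurable.aemeasurable ?_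
          refine Measurable.mul (by fun_prop) (ENNReal.measurable_ofReal.comp ?_)
          exact Measurable.mul (by fun_prop) (hm.norm.pow_const 2)
    _ ≤ ENNReal.ofReal (4 * Real.pi / √δ) * ∫⁻ y : ℝ, ENNReal.ofReal (C * δ^(-(4*κ-3)) * δ^(-(1+5*η))) * ENNReal.ofReal ((δ + y^2)⁻¹) := by
        refine mul_le_mul_right (lintegral_mono fun y => ?_) _
        refine (mul_le_mul_right (hy ω hn hr him κ hκ0 hκ1 y) _).trans ?_
        rw [← ENNReal.ofReal_mul (hD y).le, ← ENNReal.ofReal_mul (by positivity)]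
        refine ENNReal.ofReal_le_ofReal ?_
        have e : (δ + y^2)^(-(3+5*η)) = (δ + y^2)^(-(1+5*η)) * ((δ+y^2)⁻¹ * (δ+y^2)⁻¹) := by
          rw [← Real.rpow_neg_one, ← Real.rpow_add (hD y), ← Real.rpow_add (hD y)]; congr 1; ring
        have hmono : (δ + y^2)^(-(1+5*η)) ≤ δ^(-(1+5*η)) :=
          Real.rpow_le_rpow_of_nonpos hr (by nlinarith [sq_nonneg y]) (by linarith)
        have hD' := hD y
        calc _ = C * δ^(-(4*κ-3)) * (δ + y^2)^(-(1+5*η)) * (δ+y^2)⁻¹ := by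
              rw [e]; field_simp; rfl
          _ ≤ _ := by gcongr
    _ = _ := by
        rw [lintegral_const_mul' _ _ ENNReal.ofReal_ne_top, aux_int_cauchy δ hr, ← ENNReal.ofReal_mul (by positivity), ← ENNReal.ofReal_mul (by positivity)]
        congr 1
        have e : δ^(-(4*κ-1) - 5*η) = δ^(-(4*κ-3)) * δ^(-(1+5*η)) * δ⁻¹ := by
          rw [← Real.rpow_neg_one, ← Real.rpow_add hr, ← Real.rpow_add hr]; congr 1; ring
        have e2 : δ⁻¹ = (√δ)⁻¹ * (√δ)⁻¹ := by rw [← mul_inv, Real.mul_self_sqrt hr.le]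
        rw [e, e2]; ring


lemma aux_omega (θ : ℝ) (h0 : 0 < θ) (h1 : θ ≤ 1/2) : ∃ ω : ℂ, ‖ω‖ = 1 ∧ θ/2 ≤ ω.re ∧ 1/2 ≤ ω.im ∧ ω.arg = Real.pi/2 - θ := by
  have hpi := Real.pi_gt_three
  refine ⟨Complex.exp ((Real.pi/2 - θ : ℝ) * Complex.I), Complex.norm_exp_ofReal_mul_I _, ?_, ?_, ?_⟩
  · rw [Complex.exp_ofReal_mul_I_re, Real.cos_pi_div_two_sub]
    have := Real.sin_gt_sub_cube h0
    nlinarith [sq_nonneg θ, mul_pos h0 h0]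
  · rw [Complex.exp_ofReal_mul_I_im, Real.sin_pi_div_two_sub]
    have := Real.one_sub_sq_div_two_le_cos (x := θ)
    nlinarith
  · rw [Complex.arg_exp_mul_I, toIocMod_eq_self]
    constructor <;> linarith

lemma aux_mellin_lower : ∃ c, 0 < c ∧ ∀ θ : ℝ, 0 < θ → ∀ ω : ℂ, ‖ω‖ = 1 → 0 < ω.re → ω.arg = Real.pi/2 - θ →
    ∀ κ : ℝ, 3/4 ≤ κ → κ ≤ 1 → ∀ τ : ℝ, 1/2 ≤ τ →
    c * Real.exp (-(4*θ*τ)) * τ^(4*κ-2) * ‖Lchi4 ((2*κ-1 : ℝ) + (2*τ : ℝ) * Complex.I)‖^4 ≤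
      ‖mellin (fun p : ℝ => auxθ (ω * p)) (κ + τ * Complex.I)‖^4 := by
  obtain ⟨c, hc, h⟩ := aux_gamma_lower
  refine ⟨c^2, by positivity, fun θ hθ ω hn hr harg κ h0 h1 τ hτ => ?_⟩
  have hpi := Real.pi_pos
  have hpi4 : Real.pi/4 < 1 := by have := Real.pi_lt_d2; linarith
  have hω0 : ω ≠ 0 := by intro h; simp [h] at hr
  have hτ0 : 0 < τ := by linarith
  rw [aux_mellin ω hn hr _ (by simp; linarith) (by simp; linarith), norm_mul, norm_mul, norm_mul, mul_pow, mul_pow, mul_pow]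
  have e1 : ‖ω^(-((κ:ℂ) + τ * Complex.I))‖^4 = Real.exp (4*(Real.pi/2 - θ)*τ) := by
    rw [Complex.norm_cpow_of_ne_zero hω0, hn, harg]
    simp
    rw [← Real.exp_nat_mul, ← Real.exp_neg]
    congr 1; push_cast; ring
  have e2 : 1 ≤ ‖((Real.pi/4 : ℝ):ℂ)^(-((κ:ℂ) + τ * Complex.I))‖^4 := by
    refine one_le_pow₀ ?_
    rw [Complex.norm_cpow_eq_rpow_re_of_pos (by positivity)]
    refine Real.one_le_rpow_of_pos_of_le_one_of_nonpos (by positivity) hpi4.le ?_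
    simp; linarith
  have e3 : (c * τ^(2*κ-1) * Real.exp (-Real.pi*τ))^2 ≤ ‖Complex.Gamma ((κ:ℂ) + τ * Complex.I)‖^4 := by
    have := h κ h0 h1 τ hτ
    calc _ ≤ (‖Complex.Gamma ((κ:ℂ) + τ * Complex.I)‖^2)^2 := by gcongr
      _ = _ := by ring
  have e4 : 2 * ((κ:ℂ) + τ * Complex.I) - 1 = (2*κ-1 : ℝ) + (2*τ : ℝ) * Complex.I := by push_cast; ring
  rw [e4, e1]
  have e5 : c^2 * Real.exp (-(4*θ*τ)) * τ^(4*κ-2) = Real.exp (4*(Real.pi/2 - θ)*τ) * 1 * (c * τ^(2*κ-1) * Real.exp (-Real.pi*τ))^2 := by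
    rw [mul_pow, mul_pow, ← Real.rpow_natCast (τ^(2*κ-1)) 2, ← Real.rpow_mul hτ0.le, ← Real.exp_nat_mul,
      show Real.exp (-(4*θ*τ)) = Real.exp (4*(Real.pi/2 - θ)*τ) * Real.exp ((2:ℕ) * (-Real.pi*τ)) by rw [← Real.exp_add]; congr 1; push_cast; ring,
      show (2*κ-1) * ((2:ℕ):ℝ) = 4*κ-2 by push_cast; ring]
    ring
  rw [e5]
  gcongr

lemma aux_mellin_cont (ω : ℂ) (hn : ‖ω‖ = 1) (hr : 0 < ω.re) (κ : ℝ) (h0 : 3/4 ≤ κ) (h1 : κ ≤ 1) :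
    Continuous (fun τ : ℝ => mellin (fun p : ℝ => auxθ (ω * p)) (κ + τ * Complex.I)) := by
  have hω0 : ω ≠ 0 := by intro h; simp [h] at hr
  have hpi : ((Real.pi/4 : ℝ):ℂ) ≠ 0 := by exact_mod_cast (by have := Real.pi_pos; positivity : Real.pi/4 ≠ 0)
  have e : (fun τ : ℝ => mellin (fun p : ℝ => auxθ (ω * p)) (κ + τ * Complex.I)) = fun τ : ℝ =>
      ω^(-(κ + τ * Complex.I)) * ((Real.pi/4 : ℝ):ℂ)^(-(κ + τ * Complex.I)) * Complex.Gamma (κ + τ * Complex.I) * Lchi4 (2*(κ + τ * Complex.I)-1) := by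
    ext τ
    exact aux_mellin ω hn hr _ (by simp; linarith) (by simp; linarith)
  rw [e]
  refine ((Continuous.mul ?_ ?_).mul ?_).mul ?_
  · exact Continuous.const_cpow (by fun_prop) (Or.inl hω0)
  · exact Continuous.const_cpow (by fun_prop) (Or.inl hpi)
  · rw [continuous_iff_continuousAt]
    intro τ
    have hG : ContinuousAt Complex.Gamma (κ + τ * Complex.I) := by
      refine (Complex.differentiableAt_Gamma _ fun m hm => ?_).continuousAt
      have := congrArg Complex.re hm
      simp at this
      have : (0:ℝ) ≤ m := by positivity
      linarith
    exact ContinuousAt.comp (f := fun τ : ℝ => (κ:ℂ) + τ * Complex.I) hG (by fun_prop)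
  · exact auxL_diff.continuous.comp (by fun_prop)

theorem stmt_18 (ε : ℝ) (hε : 0 < ε) :
    ∃ C : ℝ, ∀ σ : ℝ, σ ∈ Set.Icc (1/2 : ℝ) 1 → ∀ U : ℝ, 1 ≤ U →
      (∫ t in U..(2*U), ‖Lchi4 (σ + t * Complex.I)‖ ^ 4) ≤ C * U ^ (1 + ε) := by
  obtain ⟨C, hC, hΦ⟩ := aux_Φ_int (ε/5) (by positivity)
  obtain ⟨c, hc, hlow⟩ := aux_mellin_lower
  have hpi := Real.pi_pos
  set A : ℝ := c * Real.exp (-2) / 4 with hA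
  have hA0 : 0 < A := by positivity
  set D : ℝ := 2 * Real.pi * Real.exp 1 * (2 * (C * 4^(3+ε))) with hD
  refine ⟨2 * (A⁻¹ * D), fun σ hσ U hU => ?_⟩
  obtain ⟨hσ0, hσ1⟩ := hσ
  have hU0 : 0 < U := by linarith
  set κ : ℝ := (σ+1)/2 with hκ
  have hκ0 : 3/4 ≤ κ := by rw [hκ]; linarith
  have hκ1 : κ ≤ 1 := by rw [hκ]; linarith
  set θ : ℝ := 1/(2*U) with hθ
  have hθ0 : 0 < θ := by positivity
  have hθ1 : θ ≤ 1/2 := by rw [hθ]; rw [div_le_div_iff₀ (by positivity) (by norm_num)]; linarith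
  obtain ⟨ω, hn, hre, him, harg⟩ := aux_omega θ hθ0 hθ1
  have hr : 0 < ω.re := by linarith
  have h4 := (aux_fourth ω hn hr κ hκ0 hκ1 (U/2) U (by positivity) (by linarith) hU0).2
  have h5 := hΦ ω hn hr him κ hκ0 hκ1
  have h6 : ω.re^(-(4*κ-1) - 5*(ε/5)) ≤ 4^(3+ε) * U^(4*κ-1+ε) := by
    have e1 : (4*U)⁻¹ ≤ ω.re := by
      refine le_trans (le_of_eq ?_) hre
      rw [hθ]; field_simp; norm_num
    calc _ ≤ ((4*U)⁻¹)^(-(4*κ-1) - 5*(ε/5)) := Real.rpow_le_rpow_of_nonpos (by positivity) e1 (by linarith)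
      _ = (4*U)^(4*κ-1+ε) := by
        rw [Real.inv_rpow (by positivity), ← Real.rpow_neg (by positivity)]; congr 1; ring
      _ = 4^(4*κ-1+ε) * U^(4*κ-1+ε) := by rw [Real.mul_rpow (by norm_num) hU0.le]
      _ ≤ _ := by
        gcongr
        · norm_num
        · linarith
  have h7 : ∫ τ in (U/2)..U, ‖mellin (fun p : ℝ => auxθ (ω * p)) (κ + τ * Complex.I)‖^4 ≤ D * U^(4*κ-1+ε) := by
    refine h4.trans ?_
    calc _ ≤ 2 * Real.pi * Real.exp 1 * (2 * (C * (4^(3+ε) * U^(4*κ-1+ε)))) := by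
          gcongr; exact h5.trans (by gcongr)
      _ = _ := by rw [hD]; ring
  have hLc : Continuous (fun τ : ℝ => ‖Lchi4 ((2*κ-1 : ℝ) + (2*τ : ℝ) * Complex.I)‖^4) :=
    (auxL_diff.continuous.comp (by fun_prop)).norm.pow 4
  have h8 : A * U^(4*κ-2) * ∫ τ in (U/2)..U, ‖Lchi4 ((2*κ-1 : ℝ) + (2*τ : ℝ) * Complex.I)‖^4 ≤ D * U^(4*κ-1+ε) := by
    refine le_trans ?_ h7
    rw [← intervalIntegral.integral_const_mul]
    refine intervalIntegral.integral_mono_on (by linarith) ((hLc.const_mul _).intervalIntegrable _ _)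
      (((aux_mellin_cont ω hn hr κ hκ0 hκ1).norm.pow 4).intervalIntegrable _ _) fun τ hτ => ?_
    obtain ⟨hτ0, hτ1⟩ := hτ
    refine le_trans ?_ (hlow θ hθ0 ω hn hr harg κ hκ0 hκ1 τ (by linarith))
    have e1 : Real.exp (-2) ≤ Real.exp (-(4*θ*τ)) := by
      refine Real.exp_le_exp.2 ?_
      have : 4*θ*τ ≤ 4*θ*U := by gcongr
      have e : 4*θ*U = 2 := by rw [hθ]; field_simp; norm_num
      linarith
    have e2 : U^(4*κ-2) / 4 ≤ τ^(4*κ-2) := by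
      calc U^(4*κ-2)/4 = (U/2)^(4*κ-2) * (2^(4*κ-2) / 4) := by
            rw [Real.div_rpow hU0.le (by norm_num)]; field_simp
        _ ≤ (U/2)^(4*κ-2) * 1 := by
            gcongr
            rw [div_le_one (by norm_num)]
            calc (2:ℝ)^(4*κ-2) ≤ 2^(2:ℝ) := Real.rpow_le_rpow_of_exponent_le (by norm_num) (by linarith)
              _ = 4 := by norm_num
        _ ≤ _ := by rw [mul_one]; exact Real.rpow_le_rpow (by positivity) hτ0 (by linarith)
    refine mul_le_mul_of_nonneg_right ?_ (by positivity)
    calc A * U^(4*κ-2) = c * Real.exp (-2) * (U^(4*κ-2)/4) := by rw [hA]; ring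
      _ ≤ _ := by gcongr
  have h9 : ∫ τ in (U/2)..U, ‖Lchi4 ((2*κ-1 : ℝ) + (2*τ : ℝ) * Complex.I)‖^4 ≤ A⁻¹ * D * U^(1+ε) := by
    have e : U^(4*κ-1+ε) = U^(4*κ-2) * U^(1+ε) := by rw [← Real.rpow_add hU0]; congr 1; ring
    rw [e] at h8
    have hUp : 0 < U^(4*κ-2) := by positivity
    rw [mul_assoc, ← div_eq_inv_mul, le_div_iff₀ hA0]
    refine le_of_mul_le_mul_left ?_ hUp
    linarith
  have h10 := intervalIntegral.integral_comp_mul_left (fun t : ℝ => ‖Lchi4 (σ + t * Complex.I)‖^4) (two_ne_zero' ℝ) (a := U/2) (b := U)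
  rw [show 2 * (U/2) = U by ring, smul_eq_mul] at h10
  have e : (2*κ-1) = σ := by rw [hκ]; ring
  rw [e, h10] at h9
  linarith
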